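/- arXiv:2301.02154 — 2 statements merged into one kernel-verified Lean document; each statement's English description precedes it below -/
import Mathlib

section
/- Let X be a T1 topological space, let F be a closed subalgebra of BC(X,ℝ) that separates points from closed sets, and let F' ⊆ F be a subfamily such that the closure (in sup norm) of the subalgebra of BC(X,ℝ) generated by F' equals F. Then there exists a homeomorphism T : e_{F'} X → e_F X between the closures of the ranges of the two evaluation maps such that T ∘ e_{F'} = e_F; in particular e_{F'} is also a topological embedding and e_{F'} X is a compactification of X homeomorphic to e_F X. -/
open BoundedContinuousFunction

/-- A family `F` of bounded continuous functions separates points from closed sets if for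
every closed `C` and `x ∉ C` some `f ∈ F` has `f x ∉ closure (f '' C)`. -/
def SeparatesPointsFromClosedSets {X : Type*} [TopologicalSpace X]
    (F : Set (BoundedContinuousFunction X ℝ)) : Prop :=
  ∀ C : Set X, IsClosed C → ∀ x ∉ C, ∃ f ∈ F, (f : X → ℝ) x ∉ closure ((f : X → ℝ) '' C)

open Filter Topology in
/-- On a T1 space, evaluation at a family separating points from closed sets is an embedding. -/
theorem SeparatesPointsFromClosedSets.isEmbedding_eval {X : Type*} [TopologicalSpace X]
    [T1Space X] {F : Set (BoundedContinuousFunction X ℝ)}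
    (hF : SeparatesPointsFromClosedSets F) :
    IsEmbedding (fun (x : X) (f : ↥F) => (f : BoundedContinuousFunction X ℝ) x) := by
  refine ⟨isInducing_iff_nhds.2 fun x => le_antisymm ?_ ?_, fun x y hxy => ?_⟩
  · exact (continuous_pi fun f : ↥F => f.1.continuous).continuousAt.le_comap
  · intro U hU
    obtain ⟨V, hVU, hV, hxV⟩ := mem_nhds_iff.1 hU
    obtain ⟨f, hf, hfx⟩ := hF Vᶜ hV.isClosed_compl x (by simpa using hxV)
    refine ⟨(fun p : ↥F → ℝ => p ⟨f, hf⟩) ⁻¹' (closure (f '' Vᶜ))ᶜ,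
      (isClosed_closure.isOpen_compl.preimage (continuous_apply _)).mem_nhds hfx, ?_⟩
    intro y hy
    by_contra hyU
    exact hy (subset_closure ⟨y, fun h => hyU (hVU h), rfl⟩)
  · by_contra hne
    obtain ⟨f, hf, hfx⟩ := hF {y} isClosed_singleton x hne
    exact hfx (subset_closure ⟨y, rfl, (congrFun hxy ⟨f, hf⟩).symm⟩)

open Filter Topology in
/-- If every member of `S` has a common limit along `u` and `v`, so does every member of the
algebra generated by `S`. -/
theorem exists_common_limit_of_mem_adjoin {X : Type*} [TopologicalSpace X]
    {S : Set (BoundedContinuousFunction X ℝ)} {u v : Filter X}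
    (hS : ∀ f ∈ S, ∃ c, Tendsto f u (𝓝 c) ∧ Tendsto f v (𝓝 c))
    {f : BoundedContinuousFunction X ℝ} (hf : f ∈ Algebra.adjoin ℝ S) :
    ∃ c, Tendsto f u (𝓝 c) ∧ Tendsto f v (𝓝 c) := by
  induction hf using Algebra.adjoin_induction with
  | mem f hf => exact hS f hf
  | algebraMap r =>
    have hr : ⇑(algebraMap ℝ (BoundedContinuousFunction X ℝ) r) = fun _ => r := by
      ext x
      simp [Algebra.algebraMap_eq_smul_one]
    rw [hr]
    exact ⟨r, tendsto_const_nhds, tendsto_const_nhds⟩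
  | add f g _ _ hf hg =>
    obtain ⟨a, ha, ha'⟩ := hf
    obtain ⟨b, hb, hb'⟩ := hg
    exact ⟨a + b, ha.add hb, ha'.add hb'⟩
  | mul f g _ _ hf hg =>
    obtain ⟨a, ha, ha'⟩ := hf
    obtain ⟨b, hb, hb'⟩ := hg
    exact ⟨a * b, ha.mul hb, ha'.mul hb'⟩

open Filter Topology in
/-- If every member of `S` has a common limit along `u` and `v`, then the limits along `u` and
`v` of a function in the closed algebra generated by `S` agree. -/
theorem limit_eq_of_mem_closure_adjoin {X : Type*} [TopologicalSpace X]
    {S : Set (BoundedContinuousFunction X ℝ)} {u v : Filter X} [u.NeBot] [v.NeBot]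
    (hS : ∀ f ∈ S, ∃ c, Tendsto f u (𝓝 c) ∧ Tendsto f v (𝓝 c))
    {f : BoundedContinuousFunction X ℝ}
    (hf : f ∈ closure (Algebra.adjoin ℝ S : Set (BoundedContinuousFunction X ℝ)))
    {a b : ℝ} (ha : Tendsto f u (𝓝 a)) (hb : Tendsto f v (𝓝 b)) : a = b := by
  refine eq_of_forall_dist_le fun ε hε => ?_
  obtain ⟨g, hg, hfg⟩ := Metric.mem_closure_iff.1 hf (ε / 2) (half_pos hε)
  obtain ⟨c, hcu, hcv⟩ := exists_common_limit_of_mem_adjoin hS hg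
  have hac : dist a c ≤ ε / 2 := le_of_tendsto (ha.dist hcu)
    (Eventually.of_forall fun x => (dist_coe_le_dist x).trans hfg.le)
  have hbc : dist b c ≤ ε / 2 := le_of_tendsto (hb.dist hcv)
    (Eventually.of_forall fun x => (dist_coe_le_dist x).trans hfg.le)
  linarith [dist_triangle_right a b c]

/-- The closure of the range of evaluation at bounded functions is compact. -/
theorem isCompact_closure_range_eval {X : Type*} [TopologicalSpace X]
    (F : Set (BoundedContinuousFunction X ℝ)) :
    IsCompact (closure (Set.range
      (fun (x : X) (f : ↥F) => (f : BoundedContinuousFunction X ℝ) x))) := by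
  refine (isCompact_univ_pi fun f : ↥F =>
    isCompact_closedBall (0 : ℝ) ‖f.1‖).closure_of_subset ?_
  rintro _ ⟨x, rfl⟩ f -
  simpa using f.1.norm_coe_le_norm x

/-- If `F` is a closed subalgebra of `BC(X,ℝ)` separating points from closed sets and
`F' ⊆ F` generates `F` as a closed subalgebra, then the compactifications `e_{F'} X` and
`e_F X` are homeomorphic via a map `T` with `T ∘ e_{F'} = e_F`; in particular `e_{F'}` is
itself an embedding. -/
theorem subfamily_generates_same_compactification {X : Type*} [TopologicalSpace X]
    [T1Space X]
    (F : Subalgebra ℝ (BoundedContinuousFunction X ℝ))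
    (hFclosed : IsClosed (F : Set (BoundedContinuousFunction X ℝ)))
    (hFsep : SeparatesPointsFromClosedSets (F : Set (BoundedContinuousFunction X ℝ)))
    (F' : Set (BoundedContinuousFunction X ℝ))
    (hF'sub : F' ⊆ (F : Set (BoundedContinuousFunction X ℝ)))
    (hgen : closure ((Algebra.adjoin ℝ F' :
        Subalgebra ℝ (BoundedContinuousFunction X ℝ)) :
        Set (BoundedContinuousFunction X ℝ)) =
      (F : Set (BoundedContinuousFunction X ℝ))) :
    letI e : X → (↥(F : Set (BoundedContinuousFunction X ℝ)) → ℝ) :=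
      fun x f => (f : BoundedContinuousFunction X ℝ) x
    letI e' : X → (↥F' → ℝ) := fun x f => (f : BoundedContinuousFunction X ℝ) x
    ∃ T : ↥(closure (Set.range e')) ≃ₜ ↥(closure (Set.range e)),
      (∀ x : X,
        ((T ⟨e' x, subset_closure (Set.mem_range_self x)⟩ :
          ↥(closure (Set.range e))) : ↥(F : Set (BoundedContinuousFunction X ℝ)) → ℝ)
          = e x) ∧
      Topology.IsEmbedding e' := by
  let e : X → (↥(F : Set (BoundedContinuousFunction X ℝ)) → ℝ) :=
    fun x f => (f : BoundedContinuousFunction X ℝ) x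
  let e' : X → (↥F' → ℝ) := fun x f => (f : BoundedContinuousFunction X ℝ) x
  let R : (↥(F : Set (BoundedContinuousFunction X ℝ)) → ℝ) → (↥F' → ℝ) :=
    fun p f => p ⟨f.1, hF'sub f.2⟩
  have hR : Continuous R := continuous_pi fun f => continuous_apply _
  have hK : IsCompact (closure (Set.range e)) := isCompact_closure_range_eval _
  have himage : R '' closure (Set.range e) = closure (Set.range e') := by
    rw [image_closure_of_isCompact hK hR.continuousOn, ← Set.range_comp]
    rfl
  have hinj : Set.InjOn R (closure (Set.range e)) := by
    intro p hp q hq hpq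
    have hu : (Filter.comap e (nhds p)).NeBot := by
      rw [Filter.comap_neBot_iff_frequently]
      exact mem_closure_iff_frequently.1 hp
    have hv : (Filter.comap e (nhds q)).NeBot := by
      rw [Filter.comap_neBot_iff_frequently]
      exact mem_closure_iff_frequently.1 hq
    funext f
    refine limit_eq_of_mem_closure_adjoin (S := F') (fun g hg => ⟨R p ⟨g, hg⟩, ?_, ?_⟩)
      (hgen.symm ▸ f.2) (tendsto_pi_nhds.1 (Filter.tendsto_comap (f := e) (x := nhds p)) f)
      (tendsto_pi_nhds.1 (Filter.tendsto_comap (f := e) (x := nhds q)) f)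
    · exact tendsto_pi_nhds.1 (Filter.tendsto_comap (f := e)) ⟨g, hF'sub hg⟩
    · rw [hpq]
      exact tendsto_pi_nhds.1 (Filter.tendsto_comap (f := e)) ⟨g, hF'sub hg⟩
  have hbij : Set.BijOn R (closure (Set.range e)) (closure (Set.range e')) :=
    himage ▸ hinj.bijOn_image
  have : CompactSpace ↥(closure (Set.range e)) := isCompact_iff_compactSpace.1 hK
  let H : ↥(closure (Set.range e)) ≃ₜ ↥(closure (Set.range e')) :=
    Continuous.homeoOfEquivCompactToT2 (f := hbij.equiv R) (hR.restrict hbij.mapsTo)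
  have hH (x : X) : H ⟨e x, subset_closure (Set.mem_range_self x)⟩ =
      ⟨e' x, subset_closure (Set.mem_range_self x)⟩ := rfl
  refine ⟨H.symm, fun x => ?_, ?_⟩
  · exact congrArg Subtype.val (H.symm_apply_eq.2 (hH x).symm)
  · have he : Topology.IsEmbedding e := hFsep.isEmbedding_eval
    exact Topology.IsEmbedding.subtypeVal.comp (H.isEmbedding.comp
      (he.codRestrict (closure (Set.range e)) fun x => subset_closure (Set.mem_range_self x)))
end

section
/- The set S of continuous quasiconvex functions f : ℝ^{2×2} → ℝ of linear growth is not separable for the metric d(f,g) = sup_z |f(z)−g(z)|/(1+|z|): there is no countable set D ⊆ S such that for every f ∈ S and every ε > 0 there is g ∈ D with d(f,g) < ε. -/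
open MeasureTheory

/-- The open unit cube `(0,1)^n` in `ℝⁿ`. -/
def unitCube (n : ℕ) : Set (Fin n → ℝ) := Set.univ.pi fun _ => Set.Ioo (0 : ℝ) 1

/-- The Jacobian matrix of a map `φ : ℝⁿ → ℝᵐ` at a point `x`. -/
noncomputable def jacobianMatrix {m n : ℕ} (φ : (Fin n → ℝ) → (Fin m → ℝ))
    (x : Fin n → ℝ) : Matrix (Fin m) (Fin n) ℝ :=
  Matrix.of fun i j => fderiv ℝ φ x (Pi.single j 1) i

/-- A continuous function on `m×n` matrices is quasiconvex if it satisfies Jensen's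
inequality against gradients of smooth compactly supported test maps on the unit cube. -/
def IsQuasiconvex {m n : ℕ} (f : Matrix (Fin m) (Fin n) ℝ → ℝ) : Prop :=
  ∀ z : Matrix (Fin m) (Fin n) ℝ, ∀ φ : (Fin n → ℝ) → (Fin m → ℝ),
    ContDiff ℝ (⊤ : ℕ∞) φ → HasCompactSupport φ → tsupport φ ⊆ unitCube n →
    f z ≤ ∫ x in unitCube n, f (z + jacobianMatrix φ x)

/-- The Euclidean (Frobenius) norm of a matrix. -/
noncomputable def frobNorm {m n : ℕ} (z : Matrix (Fin m) (Fin n) ℝ) : ℝ :=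
  Real.sqrt (∑ i, ∑ j, (z i j) ^ 2)

/-- `f` has linear growth. -/
def HasLinearGrowth {m n : ℕ} (f : Matrix (Fin m) (Fin n) ℝ → ℝ) : Prop :=
  ∃ C : ℝ, 0 ≤ C ∧ ∀ z, |f z| ≤ C * (1 + frobNorm z)

/-- The metric `d(f,g) = sup_z |f(z)-g(z)|/(1+|z|)` on functions of linear growth. -/
noncomputable def dLG {m n : ℕ} (f g : Matrix (Fin m) (Fin n) ℝ → ℝ) : ℝ :=
  ⨆ z : Matrix (Fin m) (Fin n) ℝ, |f z - g z| / (1 + frobNorm z)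

/-- For a strict order on a finite set, either there is a strictly increasing rank function with
values in `{1, …, H}`, or there is a chain with `H + 1` elements. -/
lemma exists_rank_or_exists_chain {α : Type*} [DecidableEq α] (r : α → α → Prop)
    (hirr : ∀ a, ¬ r a a) (htr : ∀ a b c, r a b → r b c → r a c) (H : ℕ) : ∀ S : Finset α,
    (∃ h : α → ℕ, (∀ c ∈ S, 1 ≤ h c ∧ h c ≤ H) ∧ ∀ a ∈ S, ∀ b ∈ S, r a b → h a < h b) ∨
    ∃ C ⊆ S, C.card = H + 1 ∧ (∀ a ∈ C, ∀ b ∈ C, a ≠ b → r a b ∨ r b a) ∧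
      ∃ a ∈ C, ∀ b ∈ C, b ≠ a → r a b := by
  classical
  induction H with
  | zero =>
    intro S
    rcases S.eq_empty_or_nonempty with rfl | ⟨a, ha⟩
    · left; exact ⟨fun _ => 0, by simp, by simp⟩
    · right
      refine ⟨{a}, by simpa using ha, by simp, ?_, a, by simp, ?_⟩ <;> simp +contextual
  | succ H ih =>
    intro S
    rcases ih (S.filter fun c => ∃ a ∈ S, r a c) with ⟨h, h1, h2⟩ | ⟨C, hCS, hcard, hch, a, haC, ha⟩
    · left
      refine ⟨fun c => if ∃ a ∈ S, r a c then h c + 1 else 1, fun c hc => ?_, fun a ha b hb hab => ?_⟩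
      · dsimp only
        split_ifs with hx
        · have := h1 c (by simp [hc, hx])
          omega
        · omega
      · have hb' : ∃ a ∈ S, r a b := ⟨a, ha, hab⟩
        dsimp only
        rw [if_pos hb']
        have := h1 b (by simp only [Finset.mem_filter]; exact ⟨hb, hb'⟩)
        split_ifs with hx
        · have := h2 a (by simp only [Finset.mem_filter]; exact ⟨ha, hx⟩) b
            (by simp only [Finset.mem_filter]; exact ⟨hb, hb'⟩) hab
          omega
        · omega
    · right
      obtain ⟨_, b, hbS, hba⟩ := Finset.mem_filter.1 (hCS haC)
      have hlt : ∀ c ∈ C, r b c := by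
        intro c hc
        by_cases hca : c = a
        · rwa [hca]
        · exact htr _ _ _ hba (ha c hc hca)
      have hbC : b ∉ C := fun hb => hirr _ (hlt b hb)
      refine ⟨insert b C, ?_, by rw [Finset.card_insert_of_notMem hbC, hcard], ?_, b,
        Finset.mem_insert_self _ _, ?_⟩
      · intro x hx
        rcases Finset.mem_insert.1 hx with rfl | hx
        · exact hbS
        · exact (Finset.mem_filter.1 (hCS hx)).1
      · intro x hx y hy hxy
        rcases Finset.mem_insert.1 hx with hx' | hx' <;>
          rcases Finset.mem_insert.1 hy with hy' | hy'
        · exact absurd (hx'.trans hy'.symm) hxy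
        · exact Or.inl (hx' ▸ hlt y hy')
        · exact Or.inr (hy' ▸ hlt x hx')
        · exact hch x hx' y hy' hxy
      · intro x hx hxb
        rcases Finset.mem_insert.1 hx with rfl | hx
        · exact absurd rfl hxb
        · exact hlt x hx

/-- Greedy removal of long chains: after removing at most `k` chains, a finite set with at most
`k * (H + 1)` elements has a rank function with values in `{1, …, H}`. -/
lemma exists_chain_colouring {α : Type*} [DecidableEq α] (r : α → α → Prop)
    (hirr : ∀ a, ¬ r a a) (htr : ∀ a b c, r a b → r b c → r a c) (H k : ℕ) : ∀ S : Finset α,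
    S.card ≤ k * (H + 1) → ∃ S₂ ⊆ S, ∃ col : α → ℕ, (∀ c ∈ S₂, col c < k) ∧
      (∀ a ∈ S₂, ∀ b ∈ S₂, a ≠ b → col a = col b → r a b ∨ r b a) ∧
      ∃ h : α → ℕ, (∀ c ∈ S \ S₂, 1 ≤ h c ∧ h c ≤ H) ∧
        ∀ a ∈ S \ S₂, ∀ b ∈ S \ S₂, r a b → h a < h b := by
  classical
  induction k with
  | zero =>
    intro S hS
    have : S = ∅ := by simpa using hS
    subst this
    exact ⟨∅, by simp, fun _ => 0, by simp, by simp, fun _ => 0, by simp, by simp⟩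
  | succ k ih =>
    intro S hS
    rcases exists_rank_or_exists_chain r hirr htr H S with ⟨h, h1, h2⟩ | ⟨C, hCS, hcard, hch, -⟩
    · exact ⟨∅, by simp, fun _ => 0, by simp, by simp, h, by simpa using h1, by simpa using h2⟩
    · obtain ⟨S₂, hS₂, col, hk, hcol, h, h1, h2⟩ := ih (S \ C) (by
        rw [Finset.card_sdiff_of_subset hCS, hcard]
        have : (k + 1) * (H + 1) = k * (H + 1) + (H + 1) := by ring
        omega)
      have hdiff : S \ (S₂ ∪ C) = (S \ C) \ S₂ := by
        ext x; simp only [Finset.mem_sdiff, Finset.mem_union]; tauto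
      have hdisj : ∀ x ∈ S₂, x ∉ C := fun x hx => (Finset.mem_sdiff.1 (hS₂ hx)).2
      refine ⟨S₂ ∪ C, Finset.union_subset (hS₂.trans Finset.sdiff_subset) hCS,
        fun c => if c ∈ C then k else col c, ?_, ?_, h, hdiff ▸ h1, hdiff ▸ h2⟩
      · intro c hc
        dsimp only
        split_ifs with hcC
        · omega
        · have := hk c ((Finset.mem_union.1 hc).resolve_right hcC)
          omega
      · intro a ha b hb hab
        dsimp only
        split_ifs with haC hbC hbC
        · exact fun _ => hch a haC b hbC hab
        · intro hc
          have := hk b ((Finset.mem_union.1 hb).resolve_right hbC)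
          omega
        · intro hc
          have := hk a ((Finset.mem_union.1 ha).resolve_right haC)
          omega
        · exact hcol a ((Finset.mem_union.1 ha).resolve_right haC) b
            ((Finset.mem_union.1 hb).resolve_right hbC) hab

/-- If two strict orders have no common comparable pair, a finite set with at most `k * (H + 1)`
elements splits into a part ranked by the first order and a part ranked by the second. -/
lemma exists_rank_split {α : Type*} [DecidableEq α] (r s : α → α → Prop)
    (hirr : ∀ a, ¬ r a a) (htr : ∀ a b c, r a b → r b c → r a c)
    (hirs : ∀ a, ¬ s a a) (hts : ∀ a b c, s a b → s b c → s a c)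
    (hrs : ∀ a b, r a b → ¬ s a b ∧ ¬ s b a) (H k : ℕ) (S : Finset α)
    (hS : S.card ≤ k * (H + 1)) :
    ∃ S₁ S₂ : Finset α, S = S₁ ∪ S₂ ∧
      (∃ h : α → ℕ, (∀ c ∈ S₁, 1 ≤ h c ∧ h c ≤ H) ∧ ∀ a ∈ S₁, ∀ b ∈ S₁, r a b → h a < h b) ∧
      ∃ h : α → ℕ, (∀ c ∈ S₂, 1 ≤ h c ∧ h c ≤ k) ∧ ∀ a ∈ S₂, ∀ b ∈ S₂, s a b → h a < h b := by
  obtain ⟨S₂, hS₂, col, hk, hcol, h1⟩ := exists_chain_colouring r hirr htr H k S hS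
  refine ⟨S \ S₂, S₂, (Finset.sdiff_union_of_subset hS₂).symm, h1, ?_⟩
  rcases exists_rank_or_exists_chain s hirs hts k S₂ with h2 | ⟨C, hC, hcard, hch, -⟩
  · exact h2
  · exfalso
    obtain ⟨a, ha, b, hb, hab, heq⟩ := Finset.exists_ne_map_eq_of_card_lt_of_maps_to
      (s := C) (t := Finset.range k) (f := col) (by simp [hcard])
      (fun c hc => by simpa using hk c (hC hc))
    have h3 := hch a ha b hb hab
    rcases hcol a (hC ha) b (hC hb) hab heq with h | h
    · have := hrs _ _ h; tauto
    · have := hrs _ _ h; tauto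

/-- A Lipschitz staircase function on the plane, nondecreasing in the direction `i`, with small
oscillation and slope one in the direction `i` near the points of a finite set that admits a
bounded rank function for the order given by the cone around the direction `i`. -/
lemma exists_staircase {i j : Fin 2} (hij : i ≠ j) {r : ℝ} (hr : 0 < r) (H : ℕ)
    (S : Finset (Fin 2 → ℝ)) (h : (Fin 2 → ℝ) → ℕ) (hH : ∀ c ∈ S, 1 ≤ h c ∧ h c ≤ H)
    (hmono : ∀ a ∈ S, ∀ b ∈ S, |b j - a j| < b i - a i → h a < h b) :
    ∃ q : (Fin 2 → ℝ) → ℝ, (∀ x y, q x ≤ q y + |x i - y i| + |x j - y j|) ∧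
      (∀ x, 0 ≤ q x ∧ q x ≤ 4 * r * H) ∧
      (∀ x, ∀ t : ℝ, 0 ≤ t → q x ≤ q (x + t • Pi.single i 1)) ∧
      ∀ c ∈ S, ∀ x, ∀ t : ℝ, 0 ≤ t → ‖x - c‖ < r → ‖x + t • Pi.single i 1 - c‖ < r →
        q x + t ≤ q (x + t • Pi.single i 1) := by
  set l : (Fin 2 → ℝ) → (Fin 2 → ℝ) → ℝ := fun c x => x i - c i - |x j - c j| + 2 * r with hl
  set f : (Fin 2 → ℝ) → (Fin 2 → ℝ) → ℝ :=
    fun c x => 4 * r * ((h c : ℝ) - 1) + min (l c x) (4 * r) with hf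
  set q : (Fin 2 → ℝ) → ℝ := fun x => ((S.sup fun c => (f c x).toNNReal : NNReal) : ℝ) with hq
  have hq0 : ∀ x, 0 ≤ q x := fun x => NNReal.coe_nonneg _
  have hfq : ∀ c ∈ S, ∀ x, f c x ≤ q x := by
    intro c hc x
    refine (Real.le_coe_toNNReal _).trans ?_
    exact_mod_cast Finset.le_sup (f := fun c => (f c x).toNNReal) hc
  have hqle : ∀ x y, 0 ≤ y → (∀ c ∈ S, f c x ≤ y) → q x ≤ y := by
    intro x y hy hc
    have : (S.sup fun c => (f c x).toNNReal) ≤ y.toNNReal :=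
      Finset.sup_le fun c hcS => Real.toNNReal_le_toNNReal (hc c hcS)
    calc q x ≤ (y.toNNReal : ℝ) := by exact_mod_cast this
      _ = y := Real.coe_toNNReal _ hy
  have hti : ∀ (x : Fin 2 → ℝ) (t : ℝ), (x + t • (Pi.single i 1 : Fin 2 → ℝ)) i = x i + t := by
    intro x t; simp
  have htj : ∀ (x : Fin 2 → ℝ) (t : ℝ), (x + t • (Pi.single i 1 : Fin 2 → ℝ)) j = x j := by
    intro x t; simp [hij.symm]
  have hlt : ∀ c x t, l c (x + t • (Pi.single i 1 : Fin 2 → ℝ)) = l c x + t := by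
    intro c x t
    simp only [hl, hti, htj]; ring
  refine ⟨q, fun x y => ?_, fun x => ⟨hq0 x, ?_⟩, fun x t ht => ?_, fun c hc x t ht hx hxt => ?_⟩
  · refine hqle x _ (by have := hq0 y; positivity) fun c hc => ?_
    have h1 := hfq c hc y
    have h2 : f c x ≤ f c y + (|x i - y i| + |x j - y j|) := by
      have h3 : l c x ≤ l c y + (|x i - y i| + |x j - y j|) := by
        have := le_abs_self (x i - y i)
        have := abs_sub_abs_le_abs_sub (y j - c j) (x j - c j)
        rw [show y j - c j - (x j - c j) = -(x j - y j) by ring, abs_neg] at this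
        simp only [hl]
        linarith
      have h4 : min (l c x) (4 * r) ≤ min (l c y) (4 * r) + (|x i - y i| + |x j - y j|) := by
        rw [← min_add_add_right]
        exact min_le_min h3 (by have := abs_nonneg (x i - y i); have := abs_nonneg (x j - y j); linarith)
      simp only [hf]; linarith
    linarith
  · refine hqle x _ (by positivity) fun c hc => ?_
    have h1 : (h c : ℝ) ≤ H := by exact_mod_cast (hH c hc).2
    have h2 := min_le_right (l c x) (4 * r)
    simp only [hf]
    nlinarith
  · refine hqle x _ (hq0 _) fun c hc => le_trans ?_ (hfq c hc _)
    simp only [hf, hlt]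
    gcongr
    linarith
  · rw [pi_norm_lt_iff hr] at hx hxt
    have hxi := abs_lt.1 (hx i)
    have hxj := hx j
    have hyi := abs_lt.1 (hxt i)
    simp only [Pi.sub_apply, Real.norm_eq_abs, hti] at hxi hxj hyi
    have hc1 : (1 : ℝ) ≤ h c := by exact_mod_cast (hH c hc).1
    have hlc : 0 ≤ l c x ∧ l c x + t ≤ 4 * r := by
      have := abs_nonneg (x j - c j)
      simp only [hl]; constructor <;> linarith
    have hfc : f c (x + t • (Pi.single i 1 : Fin 2 → ℝ)) = 4 * r * ((h c : ℝ) - 1) + l c x + t := by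
      simp only [hf, hlt]; rw [min_eq_left hlc.2]; ring
    have hbase : 4 * r * ((h c : ℝ) - 1) + t ≤ q (x + t • (Pi.single i 1 : Fin 2 → ℝ)) := by
      have := hfq c hc (x + t • (Pi.single i 1 : Fin 2 → ℝ))
      linarith
    rw [← le_sub_iff_add_le]
    refine hqle x _ ?_ fun c' hc' => ?_
    · have : 0 ≤ 4 * r * ((h c : ℝ) - 1) := by
        have : 0 ≤ (h c : ℝ) - 1 := by linarith
        positivity
      linarith
    · rcases le_or_gt (l c' x + t) (4 * r) with hle | hgt
      · have h1 := hfq c' hc' (x + t • (Pi.single i 1 : Fin 2 → ℝ))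
        have h2 := min_le_left (l c' x) (4 * r)
        simp only [hf, hlt] at h1 ⊢
        rw [min_eq_left hle] at h1
        linarith
      · have hlt' : |c j - c' j| < c i - c' i := by
          have h3 : |c j - c' j| ≤ |x j - c j| + |x j - c' j| := by
            have := abs_sub (x j - c' j) (x j - c j)
            rw [show x j - c' j - (x j - c j) = c j - c' j by ring] at this
            linarith
          simp only [hl] at hgt
          linarith
        have h4 := hmono c' hc' c hc hlt'
        have h5 : (h c' : ℝ) + 1 ≤ h c := by exact_mod_cast h4
        have h6 := min_le_right (l c' x) (4 * r)
        simp only [hf]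
        nlinarith

lemma measurableSet_unitCube (d : ℕ) : MeasurableSet (unitCube d) :=
  MeasurableSet.univ_pi fun _ => measurableSet_Ioo

lemma mem_unitCube {d : ℕ} {x : Fin d → ℝ} : x ∈ unitCube d ↔ ∀ i, 0 < x i ∧ x i < 1 := by
  simp [unitCube]

lemma unitCube_ae_eq (d : ℕ) :
    unitCube d =ᵐ[volume] (Set.univ.pi fun _ : Fin d => Set.Ico (0 : ℝ) 1) :=
  (Measure.univ_pi_Ioo_ae_eq_Icc (f := fun _ : Fin d => (0 : ℝ)) (g := fun _ => 1)).trans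
    (Measure.univ_pi_Ico_ae_eq_Icc (f := fun _ : Fin d => (0 : ℝ)) (g := fun _ => 1)).symm

lemma volume_unitCube (d : ℕ) : volume (unitCube d) = 1 := by
  simp [unitCube, volume_pi_pi]

lemma integral_const_unitCube (d : ℕ) (c : ℝ) : ∫ _ in unitCube d, c = c := by
  simp [Measure.real, volume_unitCube]

lemma integrableOn_unitCube {d : ℕ} {g : (Fin d → ℝ) → ℝ} (hg : Continuous g) :
    IntegrableOn g (unitCube d) := by
  refine (hg.integrableOn_Icc (a := 0) (b := 1)).mono_set fun x hx => ?_
  rw [mem_unitCube] at hx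
  exact ⟨fun i => (hx i).1.le, fun i => (hx i).2.le⟩

/-- Splitting an integral over the unit cube into integrals over the cells of a uniform grid. -/
lemma integral_unitCube_eq_sum {d : ℕ} {g : (Fin d → ℝ) → ℝ} (hg : IntegrableOn g (unitCube d))
    {N : ℕ} (hN : 0 < N) :
    ∫ x in unitCube d, g x = ((N : ℝ) ^ d)⁻¹ * ∑ k : Fin d → Fin N,
      ∫ y in unitCube d, g ((N : ℝ)⁻¹ • (y + fun i => ((k i : ℕ) : ℝ))) := by
  have hN' : (0 : ℝ) < N := by exact_mod_cast hN
  set Q' : Set (Fin d → ℝ) := Set.univ.pi fun _ => Set.Ico (0 : ℝ) 1 with hQ'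
  have hQm : MeasurableSet Q' := MeasurableSet.univ_pi fun _ => measurableSet_Ico
  set v : (Fin d → Fin N) → (Fin d → ℝ) := fun k i => ((k i : ℕ) : ℝ) with hv
  set B : (Fin d → Fin N) → Set (Fin d → ℝ) := fun k => {x | (N : ℝ) • x - v k ∈ Q'} with hB
  have hBm : ∀ k, MeasurableSet (B k) := fun k =>
    hQm.preimage (f := fun x => (N : ℝ) • x - v k) (by fun_prop)
  have hmemB : ∀ k x, x ∈ B k ↔ ∀ i, (k i : ℕ) ≤ N * x i ∧ N * x i < (k i : ℕ) + 1 := by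
    intro k x
    simp only [hB, hQ', hv, Set.mem_ofPred_eq, Set.mem_univ_pi, Set.mem_Ico, Pi.sub_apply,
      Pi.smul_apply, smul_eq_mul]
    refine forall_congr' fun i => ?_
    constructor <;> rintro ⟨h1, h2⟩ <;> constructor <;> linarith
  have hmemQ : ∀ x, x ∈ Q' ↔ ∀ i, 0 ≤ x i ∧ x i < 1 := by simp [hQ']
  have hBQ : ∀ k, B k ⊆ Q' := by
    intro k x hx
    rw [hmemB] at hx
    rw [hmemQ]
    intro i
    have h1 := hx i
    have h2 : ((k i : ℕ) : ℝ) + 1 ≤ N := by exact_mod_cast (k i).2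
    have h3 : (0 : ℝ) ≤ (k i : ℕ) := Nat.cast_nonneg _
    constructor
    · by_contra! h; nlinarith
    · by_contra! h; nlinarith
  have hind : ∀ x, Q'.indicator g x = ∑ k, (B k).indicator g x := by
    intro x
    by_cases hx : x ∈ Q'
    · have hx' := (hmemQ x).1 hx
      have hfl : ∀ i, ⌊(N : ℝ) * x i⌋₊ < N := fun i => by
        rw [Nat.floor_lt (mul_nonneg hN'.le (hx' i).1)]
        nlinarith [(hx' i).2]
      have huniq : ∀ k, x ∈ B k → k = fun i => ⟨⌊(N : ℝ) * x i⌋₊, hfl i⟩ := by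
        intro k hk
        ext i
        exact ((Nat.floor_eq_iff (mul_nonneg hN'.le (hx' i).1)).2 ((hmemB k x).1 hk i)).symm
      rw [Finset.sum_eq_single (fun i => ⟨⌊(N : ℝ) * x i⌋₊, hfl i⟩)]
      · rw [Set.indicator_of_mem hx, Set.indicator_of_mem]
        rw [hmemB]
        exact fun i => ⟨Nat.floor_le (mul_nonneg hN'.le (hx' i).1), Nat.lt_floor_add_one _⟩
      · exact fun k _ hk => Set.indicator_of_notMem (fun h => hk (huniq k h)) _
      · simp
    · rw [Set.indicator_of_notMem hx, Finset.sum_eq_zero]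
      exact fun k _ => Set.indicator_of_notMem (fun h => hx (hBQ k h)) _
  have hgQ : IntegrableOn g Q' := hg.congr_set_ae (unitCube_ae_eq d).symm
  have hcell : ∀ k, ∫ y in unitCube d, g ((N : ℝ)⁻¹ • (y + v k)) =
      (N : ℝ) ^ d * ∫ x, (B k).indicator g x := by
    intro k
    rw [setIntegral_congr_set (unitCube_ae_eq d), ← integral_indicator hQm]
    have : ∀ y, Q'.indicator (fun y => g ((N : ℝ)⁻¹ • (y + v k))) y =
        (fun z => (B k).indicator g ((N : ℝ)⁻¹ • z)) (y + v k) := by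
      intro y
      have : (N : ℝ)⁻¹ • (y + v k) ∈ B k ↔ y ∈ Q' := by
        simp only [hB, Set.mem_ofPred_eq]
        rw [smul_inv_smul₀ hN'.ne', add_sub_cancel_right]
      by_cases hy : y ∈ Q'
      · rw [Set.indicator_of_mem hy]
        dsimp only
        rw [Set.indicator_of_mem (this.2 hy)]
      · rw [Set.indicator_of_notMem hy]
        dsimp only
        rw [Set.indicator_of_notMem (fun h => hy (this.1 h))]
    simp_rw [this]
    rw [integral_add_right_eq_self (fun z => (B k).indicator g ((N : ℝ)⁻¹ • z)),
      Measure.integral_comp_inv_smul_of_nonneg _ _ hN'.le]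
    simp
  refine Eq.trans ?_ (congrArg _ (Finset.sum_congr rfl fun k _ => (hcell k).symm))
  rw [← Finset.mul_sum, ← mul_assoc, inv_mul_cancel₀ (by positivity), one_mul,
    setIntegral_congr_set (unitCube_ae_eq d), ← integral_indicator hQm]
  simp_rw [hind]
  rw [integral_finsetSum]
  intro k _
  exact (hgQ.mono_set (hBQ k)).integrable_indicator (hBm k)

/-- The smooth test maps with compact support in the open unit cube. -/
def testMaps (m n : ℕ) : Set ((Fin n → ℝ) → (Fin m → ℝ)) :=
  {φ | ContDiff ℝ (⊤ : ℕ∞) φ ∧ HasCompactSupport φ ∧ tsupport φ ⊆ unitCube n}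

lemma zero_mem_testMaps (m n : ℕ) : (fun _ => 0 : (Fin n → ℝ) → (Fin m → ℝ)) ∈ testMaps m n := by
  refine ⟨contDiff_const, HasCompactSupport.zero, ?_⟩
  have : tsupport (fun _ => 0 : (Fin n → ℝ) → (Fin m → ℝ)) = ∅ := by
    rw [tsupport_eq_empty_iff]; rfl
  simp [this]

lemma jacobianMatrix_zero (m n : ℕ) (x : Fin n → ℝ) :
    jacobianMatrix (fun _ => 0 : (Fin n → ℝ) → (Fin m → ℝ)) x = 0 := by
  ext i j
  simp [jacobianMatrix]

lemma continuous_jacobianMatrix {m n : ℕ} {φ : (Fin n → ℝ) → (Fin m → ℝ)}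
    (hφ : ContDiff ℝ (⊤ : ℕ∞) φ) : Continuous (jacobianMatrix φ) := by
  refine continuous_matrix fun i j => ?_
  have h := hφ.continuous_fderiv (by simp)
  exact (continuous_apply i).comp (h.clm_apply continuous_const)

/-- The entrywise `ℓ¹` norm of a matrix. -/
def entrySum {m n : ℕ} (z : Matrix (Fin m) (Fin n) ℝ) : ℝ := ∑ i, ∑ j, |z i j|

lemma continuous_entrySum {m n : ℕ} :
    Continuous (entrySum : Matrix (Fin m) (Fin n) ℝ → ℝ) := by
  unfold entrySum
  refine continuous_finsetSum _ fun i _ => continuous_finsetSum _ fun j _ => ?_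
  exact (continuous_id.matrix_elem i j).abs

/-- One-sided form of Lipschitz continuity with respect to `entrySum`. -/
def EntryLipschitz {m n : ℕ} (L : ℝ) (F : Matrix (Fin m) (Fin n) ℝ → ℝ) : Prop :=
  ∀ z w, F z ≤ F w + L * entrySum (z - w)

lemma entrySum_sub_comm {m n : ℕ} (z w : Matrix (Fin m) (Fin n) ℝ) :
    entrySum (z - w) = entrySum (w - z) := by
  simp [entrySum, abs_sub_comm]

lemma EntryLipschitz.continuous {m n : ℕ} {L : ℝ} {F : Matrix (Fin m) (Fin n) ℝ → ℝ}
    (hF : EntryLipschitz L F) : Continuous F := by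
  rw [continuous_iff_continuousAt]
  intro w
  rw [ContinuousAt, tendsto_iff_norm_sub_tendsto_zero]
  have h0 : Filter.Tendsto (fun z => L * entrySum (z - w)) (nhds w) (nhds 0) := by
    have : Continuous fun z : Matrix (Fin m) (Fin n) ℝ => L * entrySum (z - w) :=
      continuous_const.mul (continuous_entrySum.comp (continuous_id.sub continuous_const))
    simpa [entrySum] using this.tendsto w
  refine squeeze_zero (fun _ => norm_nonneg _) (fun z => ?_) h0
  rw [Real.norm_eq_abs, abs_le]
  have h1 := hF z w
  have h2 := hF w z
  rw [entrySum_sub_comm] at h2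
  constructor <;> linarith

/-- The quasiconvex envelope, given by minimising over test maps. -/
noncomputable def quasiEnvelope {m n : ℕ} (F : Matrix (Fin m) (Fin n) ℝ → ℝ)
    (z : Matrix (Fin m) (Fin n) ℝ) : ℝ :=
  ⨅ φ : testMaps m n, ∫ x in unitCube n, F (z + jacobianMatrix φ x)

section envelope

variable {m n : ℕ} {L : ℝ} {F : Matrix (Fin m) (Fin n) ℝ → ℝ}

lemma integral_nonneg_unitCube (h0 : ∀ z, 0 ≤ F z) (z : Matrix (Fin m) (Fin n) ℝ)
    (φ : (Fin n → ℝ) → (Fin m → ℝ)) : 0 ≤ ∫ x in unitCube n, F (z + jacobianMatrix φ x) :=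
  integral_nonneg fun _ => h0 _

lemma quasiEnvelope_le (h0 : ∀ z, 0 ≤ F z) (z : Matrix (Fin m) (Fin n) ℝ)
    {φ : (Fin n → ℝ) → (Fin m → ℝ)} (hφ : φ ∈ testMaps m n) :
    quasiEnvelope F z ≤ ∫ x in unitCube n, F (z + jacobianMatrix φ x) := by
  have hb : BddBelow (Set.range fun φ : testMaps m n =>
      ∫ x in unitCube n, F (z + jacobianMatrix (φ : (Fin n → ℝ) → (Fin m → ℝ)) x)) := by
    refine ⟨0, ?_⟩
    rintro _ ⟨φ, rfl⟩
    exact integral_nonneg_unitCube h0 z φ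
  unfold quasiEnvelope
  exact ciInf_le hb (⟨φ, hφ⟩ : testMaps m n)

lemma le_quasiEnvelope {z : Matrix (Fin m) (Fin n) ℝ} {a : ℝ}
    (h : ∀ φ ∈ testMaps m n, a ≤ ∫ x in unitCube n, F (z + jacobianMatrix φ x)) :
    a ≤ quasiEnvelope F z :=
  haveI : Nonempty (testMaps m n) := ⟨⟨_, zero_mem_testMaps m n⟩⟩
  le_ciInf fun φ => h φ φ.2

lemma quasiEnvelope_nonneg (h0 : ∀ z, 0 ≤ F z) (z : Matrix (Fin m) (Fin n) ℝ) :
    0 ≤ quasiEnvelope F z :=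
  le_quasiEnvelope fun φ _ => integral_nonneg_unitCube h0 z φ

lemma quasiEnvelope_le_self (h0 : ∀ z, 0 ≤ F z) (z : Matrix (Fin m) (Fin n) ℝ) :
    quasiEnvelope F z ≤ F z := by
  have := quasiEnvelope_le h0 z (zero_mem_testMaps m n)
  simp only [jacobianMatrix_zero, add_zero] at this
  rwa [integral_const_unitCube] at this

lemma exists_testMap_lt (z : Matrix (Fin m) (Fin n) ℝ) {a : ℝ} (h : quasiEnvelope F z < a) :
    ∃ φ ∈ testMaps m n, ∫ x in unitCube n, F (z + jacobianMatrix φ x) < a := by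
  by_contra! hc
  exact absurd (le_quasiEnvelope hc) (not_le.2 h)

lemma EntryLipschitz.integrableOn (hF : EntryLipschitz L F) (z : Matrix (Fin m) (Fin n) ℝ)
    {φ : (Fin n → ℝ) → (Fin m → ℝ)} (hφ : ContDiff ℝ (⊤ : ℕ∞) φ) :
    IntegrableOn (fun x => F (z + jacobianMatrix φ x)) (unitCube n) :=
  integrableOn_unitCube (hF.continuous.comp (continuous_const.add (continuous_jacobianMatrix hφ)))

lemma entryLipschitz_quasiEnvelope (h0 : ∀ z, 0 ≤ F z) (hF : EntryLipschitz L F) :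
    EntryLipschitz L (quasiEnvelope F) := by
  intro z w
  rw [← sub_le_iff_le_add]
  refine le_quasiEnvelope fun φ hφ => ?_
  rw [sub_le_iff_le_add]
  refine (quasiEnvelope_le h0 z hφ).trans ?_
  rw [← integral_const_unitCube n (L * entrySum (z - w)), ← integral_add (hF.integrableOn w hφ.1)
    (integrableOn_unitCube continuous_const)]
  refine integral_mono (hF.integrableOn z hφ.1)
    ((hF.integrableOn w hφ.1).add (integrableOn_unitCube continuous_const)) fun x => ?_
  have := hF (z + jacobianMatrix φ x) (w + jacobianMatrix φ x)
  rwa [add_sub_add_right_eq_sub] at this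

/-- A smooth map perturbed on each cell of the grid of mesh `1 / N` by a rescaled test map. -/
noncomputable def gridPerturbation {N : ℕ} (φ : (Fin n → ℝ) → (Fin m → ℝ))
    (ψ : (Fin n → Fin N) → (Fin n → ℝ) → (Fin m → ℝ)) (x : Fin n → ℝ) : Fin m → ℝ :=
  φ x + ∑ k, (N : ℝ)⁻¹ • ψ k ((N : ℝ) • x - fun i => ((k i : ℕ) : ℝ))

lemma contDiff_gridPerturbation {N : ℕ} {φ : (Fin n → ℝ) → (Fin m → ℝ)}
    {ψ : (Fin n → Fin N) → (Fin n → ℝ) → (Fin m → ℝ)} (hφ : ContDiff ℝ (⊤ : ℕ∞) φ)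
    (hψ : ∀ k, ContDiff ℝ (⊤ : ℕ∞) (ψ k)) : ContDiff ℝ (⊤ : ℕ∞) (gridPerturbation φ ψ) := by
  refine hφ.add (ContDiff.sum fun k _ => ?_)
  exact ((hψ k).comp ((contDiff_id.const_smul (N : ℝ)).sub contDiff_const)).const_smul _

lemma jacobianMatrix_gridPerturbation {N : ℕ} (hN : 0 < N) {φ : (Fin n → ℝ) → (Fin m → ℝ)}
    {ψ : (Fin n → Fin N) → (Fin n → ℝ) → (Fin m → ℝ)} (hφ : ContDiff ℝ (⊤ : ℕ∞) φ)
    (hψ : ∀ k, ContDiff ℝ (⊤ : ℕ∞) (ψ k)) (x : Fin n → ℝ) :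
    jacobianMatrix (gridPerturbation φ ψ) x = jacobianMatrix φ x +
      ∑ k, jacobianMatrix (ψ k) ((N : ℝ) • x - fun i => ((k i : ℕ) : ℝ)) := by
  have hN' : (N : ℝ) ≠ 0 := by exact_mod_cast hN.ne'
  have h1 := (hφ.differentiable (by simp) x).hasFDerivAt
  have h2 : ∀ k, HasFDerivAt
      (fun x => (N : ℝ)⁻¹ • ψ k ((N : ℝ) • x - fun i => ((k i : ℕ) : ℝ)))
      (fderiv ℝ (ψ k) ((N : ℝ) • x - fun i => ((k i : ℕ) : ℝ))) x := by
    intro k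
    have h3 := ((hψ k).differentiable (by simp) ((N : ℝ) • x - fun i => ((k i : ℕ) : ℝ))).hasFDerivAt
    have h4 : HasFDerivAt (fun x : Fin n → ℝ => (N : ℝ) • x - fun i => ((k i : ℕ) : ℝ))
        ((N : ℝ) • ContinuousLinearMap.id ℝ (Fin n → ℝ)) x :=
      ((hasFDerivAt_id x).const_smul (N : ℝ)).sub_const _
    have h5 := (h3.comp x h4).const_smul (N : ℝ)⁻¹
    refine h5.congr_fderiv ?_
    ext v i
    simp [hN']
  have h6 : HasFDerivAt (gridPerturbation φ ψ) _ x := h1.add (HasFDerivAt.fun_sum fun k _ => h2 k)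
  ext i j
  simp only [jacobianMatrix, h6.fderiv, Matrix.of_apply, Matrix.add_apply, Matrix.sum_apply]
  simp [Finset.sum_apply]

lemma jacobianMatrix_eq_zero {φ : (Fin n → ℝ) → (Fin m → ℝ)} {x : Fin n → ℝ}
    (hx : x ∉ tsupport φ) : jacobianMatrix φ x = 0 := by
  ext i j
  simp [jacobianMatrix, fderiv_of_notMem_tsupport ℝ hx]

lemma gridPerturbation_mem {N : ℕ} (hN : 0 < N) {φ : (Fin n → ℝ) → (Fin m → ℝ)}
    {ψ : (Fin n → Fin N) → (Fin n → ℝ) → (Fin m → ℝ)} (hφ : φ ∈ testMaps m n)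
    (hψ : ∀ k, ψ k ∈ testMaps m n) : gridPerturbation φ ψ ∈ testMaps m n := by
  have hN' : (0 : ℝ) < N := by exact_mod_cast hN
  set a : (Fin n → Fin N) → (Fin n → ℝ) → (Fin n → ℝ) :=
    fun k y => (N : ℝ)⁻¹ • (y + fun i => ((k i : ℕ) : ℝ)) with ha
  set K : Set (Fin n → ℝ) := tsupport φ ∪ ⋃ k, a k '' tsupport (ψ k) with hK
  have hKc : IsCompact K := by
    refine IsCompact.union hφ.2.1 (isCompact_iUnion fun k => ?_)
    refine IsCompact.image (hψ k).2.1 ?_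
    simp only [ha]; fun_prop
  have hKQ : K ⊆ unitCube n := by
    refine Set.union_subset hφ.2.2 (Set.iUnion_subset fun k => ?_)
    rintro _ ⟨y, hy, rfl⟩
    have hy' := mem_unitCube.1 ((hψ k).2.2 hy)
    rw [mem_unitCube]
    intro i
    have h1 : ((k i : ℕ) : ℝ) + 1 ≤ N := by exact_mod_cast (k i).2
    have h2 : (0 : ℝ) ≤ (k i : ℕ) := Nat.cast_nonneg _
    have h3 := hy' i
    simp only [ha, Pi.smul_apply, Pi.add_apply, smul_eq_mul]
    constructor
    · have : 0 < y i + (k i : ℕ) := by linarith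
      positivity
    · rw [inv_mul_lt_iff₀ hN']; linarith
  have hsupp : ∀ x, x ∉ K → gridPerturbation φ ψ x = 0 := by
    intro x hx
    have h1 : φ x = 0 := image_eq_zero_of_notMem_tsupport fun h => hx (Or.inl h)
    have h2 : ∀ k, ψ k ((N : ℝ) • x - fun i => ((k i : ℕ) : ℝ)) = 0 := by
      intro k
      refine image_eq_zero_of_notMem_tsupport fun h => hx (Or.inr ?_)
      refine Set.mem_iUnion.2 ⟨k, _, h, ?_⟩
      simp only [ha, sub_add_cancel]
      exact inv_smul_smul₀ hN'.ne' x
    simp [gridPerturbation, h1, h2]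
  refine ⟨contDiff_gridPerturbation hφ.1 fun k => (hψ k).1, HasCompactSupport.intro hKc hsupp, ?_⟩
  refine (closure_minimal (fun x hx => ?_) hKc.isClosed).trans hKQ
  by_contra h
  exact hx (hsupp x h)

lemma jacobianMatrix_gridPerturbation_cell {N : ℕ} (hN : 0 < N) {φ : (Fin n → ℝ) → (Fin m → ℝ)}
    {ψ : (Fin n → Fin N) → (Fin n → ℝ) → (Fin m → ℝ)} (hφ : φ ∈ testMaps m n)
    (hψ : ∀ k, ψ k ∈ testMaps m n) (k : Fin n → Fin N) {y : Fin n → ℝ} (hy : y ∈ unitCube n) :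
    jacobianMatrix (gridPerturbation φ ψ) ((N : ℝ)⁻¹ • (y + fun i => ((k i : ℕ) : ℝ))) =
      jacobianMatrix φ ((N : ℝ)⁻¹ • (y + fun i => ((k i : ℕ) : ℝ))) + jacobianMatrix (ψ k) y := by
  have hN' : (N : ℝ) ≠ 0 := by exact_mod_cast hN.ne'
  rw [jacobianMatrix_gridPerturbation hN hφ.1 fun k => (hψ k).1, smul_inv_smul₀ hN',
    Finset.sum_eq_single k]
  · rw [add_sub_cancel_right]
  · intro l _ hl
    refine jacobianMatrix_eq_zero fun h => hl ?_
    have h1 := mem_unitCube.1 ((hψ l).2.2 h)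
    have h2 := mem_unitCube.1 hy
    ext i
    have h3 := h1 i
    have h4 := h2 i
    simp only [Pi.sub_apply, Pi.add_apply] at h3
    have h5 : ((l i : ℕ) : ℝ) < (k i : ℕ) + 1 := by linarith
    have h6 : ((k i : ℕ) : ℝ) < (l i : ℕ) + 1 := by linarith
    norm_cast at h5 h6
    omega
  · simp

/-- Uniform continuity of the Jacobian matrix of a test map. -/
lemma exists_mesh {φ : (Fin n → ℝ) → (Fin m → ℝ)} (hφ : φ ∈ testMaps m n) {ε : ℝ} (hε : 0 < ε) :
    ∃ δ > 0, ∀ x y, ‖x - y‖ < δ → entrySum (jacobianMatrix φ x - jacobianMatrix φ y) < ε := by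
  have huc : ∀ i j, UniformContinuous fun x => jacobianMatrix φ x i j := by
    intro i j
    refine Continuous.uniformContinuous_of_tendsto_cocompact (x := 0)
      ((continuous_jacobianMatrix hφ.1).matrix_elem i j) ?_
    refine HasCompactSupport.is_zero_at_infty ?_
    refine HasCompactSupport.intro hφ.2.1 fun x hx => ?_
    simp [jacobianMatrix_eq_zero hx]
  have hpi : UniformContinuous fun x => fun p : Fin m × Fin n => jacobianMatrix φ x p.1 p.2 :=
    uniformContinuous_pi.2 fun p => huc p.1 p.2
  obtain ⟨δ, hδ, h⟩ := Metric.uniformContinuous_iff.1 hpi (ε / (m * n + 1)) (by positivity)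
  refine ⟨δ, hδ, fun x y hxy => ?_⟩
  have h1 := h (a := x) (b := y) (by rwa [dist_eq_norm])
  have h2 : ∀ i j, |(jacobianMatrix φ x - jacobianMatrix φ y) i j| ≤ ε / (m * n + 1) := by
    intro i j
    have := (dist_le_pi_dist (fun p : Fin m × Fin n => jacobianMatrix φ x p.1 p.2)
      (fun p : Fin m × Fin n => jacobianMatrix φ y p.1 p.2) (i, j)).trans h1.le
    simpa [Real.dist_eq] using this
  calc entrySum (jacobianMatrix φ x - jacobianMatrix φ y)
      ≤ ∑ i : Fin m, ∑ j : Fin n, ε / (m * n + 1) :=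
        Finset.sum_le_sum fun i _ => Finset.sum_le_sum fun j _ => h2 i j
    _ = (m * n) * (ε / (m * n + 1)) := by simp; ring
    _ < ε := by
        rw [mul_div_assoc', div_lt_iff₀ (by positivity)]
        nlinarith

lemma norm_smul_sub_smul_le {N : ℕ} (hN : 0 < N) {y : Fin n → ℝ} (hy : y ∈ unitCube n)
    (v : Fin n → ℝ) : ‖(N : ℝ)⁻¹ • (y + v) - (N : ℝ)⁻¹ • v‖ ≤ (N : ℝ)⁻¹ := by
  rw [← smul_sub, add_sub_cancel_right, norm_smul, norm_inv, Real.norm_natCast]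
  refine mul_le_of_le_one_right (by positivity) ((pi_norm_le_iff_of_nonneg zero_le_one).2 fun i => ?_)
  have := mem_unitCube.1 hy i
  rw [Real.norm_eq_abs, abs_le]
  constructor <;> linarith

/-- The envelope of a nonnegative Lipschitz function is quasiconvex. -/
theorem isQuasiconvex_quasiEnvelope (h0 : ∀ z, 0 ≤ F z) (hL : 0 ≤ L) (hF : EntryLipschitz L F) :
    IsQuasiconvex (quasiEnvelope F) := by
  intro z φ hφ1 hφ2 hφ3
  have hφ : φ ∈ testMaps m n := ⟨hφ1, hφ2, hφ3⟩
  have hQ := entryLipschitz_quasiEnvelope h0 hF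
  refine le_of_forall_pos_le_add fun ε' hε' => ?_
  obtain ⟨ε, hε, hεε⟩ : ∃ ε > 0, (2 * L + 1) * ε ≤ ε' :=
    ⟨ε' / (2 * L + 1), by positivity, by rw [mul_div_cancel₀]; positivity⟩
  obtain ⟨δ, hδ, hosc⟩ := exists_mesh hφ hε
  obtain ⟨N', hN'⟩ := exists_nat_one_div_lt hδ
  set N := N' + 1 with hNdef
  have hN : 0 < N := Nat.succ_pos _
  set v : (Fin n → Fin N) → (Fin n → ℝ) := fun k i => ((k i : ℕ) : ℝ) with hv
  set c : (Fin n → Fin N) → Matrix (Fin m) (Fin n) ℝ :=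
    fun k => jacobianMatrix φ ((N : ℝ)⁻¹ • v k) with hc
  have hcell : ∀ k, ∀ y ∈ unitCube n,
      entrySum (jacobianMatrix φ ((N : ℝ)⁻¹ • (y + v k)) - c k) < ε := by
    intro k y hy
    refine hosc _ _ ((norm_smul_sub_smul_le hN hy _).trans_lt ?_)
    rw [hNdef, ← one_div]; push_cast; exact hN'
  have hψ : ∀ k, ∃ ψ ∈ testMaps m n, ∫ x in unitCube n, F (z + c k + jacobianMatrix ψ x) <
      quasiEnvelope F (z + c k) + ε := fun k => exists_testMap_lt _ (by linarith)
  choose ψ hψ hψlt using hψ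
  have hΨ := gridPerturbation_mem hN hφ hψ
  refine (quasiEnvelope_le h0 z hΨ).trans ?_
  have hQint : IntegrableOn (fun x => quasiEnvelope F (z + jacobianMatrix φ x)) (unitCube n) :=
    hQ.integrableOn z hφ1
  have hadd : (∫ x in unitCube n, quasiEnvelope F (z + jacobianMatrix φ x)) + ε' =
      ∫ x in unitCube n, (quasiEnvelope F (z + jacobianMatrix φ x) + ε') := by
    rw [integral_add hQint (integrableOn_unitCube continuous_const), integral_const_unitCube]
  rw [hadd, integral_unitCube_eq_sum (hF.integrableOn z hΨ.1) hN,
    integral_unitCube_eq_sum (g := fun x => quasiEnvelope F (z + jacobianMatrix φ x) + ε')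
      (hQint.add (integrableOn_unitCube continuous_const)) hN]
  refine mul_le_mul_of_nonneg_left (Finset.sum_le_sum fun k _ => ?_) (by positivity)
  have hcont : Continuous fun y => jacobianMatrix φ ((N : ℝ)⁻¹ • (y + v k)) :=
    (continuous_jacobianMatrix hφ1).comp (by fun_prop)
  have h_int_cell : IntegrableOn (fun y => F (z + c k + jacobianMatrix (ψ k) y)) (unitCube n) :=
    hF.integrableOn _ (hψ k).1
  calc ∫ y in unitCube n, F (z + jacobianMatrix (gridPerturbation φ ψ) ((N : ℝ)⁻¹ • (y + v k)))
      ≤ ∫ y in unitCube n, (F (z + c k + jacobianMatrix (ψ k) y) + L * ε) := by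
        refine setIntegral_mono_on ?_ (h_int_cell.add (integrableOn_unitCube continuous_const))
          (measurableSet_unitCube n) fun y hy => ?_
        · exact integrableOn_unitCube (hF.continuous.comp (continuous_const.add
            ((continuous_jacobianMatrix hΨ.1).comp (by fun_prop))))
        · rw [jacobianMatrix_gridPerturbation_cell hN hφ hψ k hy]
          refine (hF _ (z + c k + jacobianMatrix (ψ k) y)).trans ?_
          have h1 := hcell k y hy
          have h2 : z + (jacobianMatrix φ ((N : ℝ)⁻¹ • (y + v k)) + jacobianMatrix (ψ k) y) -
              (z + c k + jacobianMatrix (ψ k) y) =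
              jacobianMatrix φ ((N : ℝ)⁻¹ • (y + v k)) - c k := by abel
          rw [show (fun i => ((k i : ℕ) : ℝ)) = v k from rfl, h2]
          gcongr
    _ = (∫ y in unitCube n, F (z + c k + jacobianMatrix (ψ k) y)) + L * ε := by
        rw [integral_add h_int_cell (integrableOn_unitCube continuous_const), integral_const_unitCube]
    _ ≤ quasiEnvelope F (z + c k) + (ε + L * ε) := by linarith [hψlt k]
    _ = ∫ y in unitCube n, (quasiEnvelope F (z + c k) + (ε + L * ε)) :=
        (integral_const_unitCube n _).symm
    _ ≤ ∫ y in unitCube n, (quasiEnvelope F (z + jacobianMatrix φ ((N : ℝ)⁻¹ • (y + v k))) + ε') := by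
        refine setIntegral_mono_on (integrableOn_unitCube continuous_const) ?_
          (measurableSet_unitCube n) fun y hy => ?_
        · exact integrableOn_unitCube ((hQ.continuous.comp (continuous_const.add hcont)).add
            continuous_const)
        · have h1 := hQ (z + c k) (z + jacobianMatrix φ ((N : ℝ)⁻¹ • (y + v k)))
          have h2 := (hcell k y hy).le
          rw [add_sub_add_left_eq_sub, entrySum_sub_comm] at h1
          have h3 := mul_le_mul_of_nonneg_left h2 hL
          linarith

lemma hasLinearGrowth_quasiEnvelope (h0 : ∀ z, 0 ≤ F z) (hL : 0 ≤ L) (hF : EntryLipschitz L F) :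
    HasLinearGrowth (quasiEnvelope F) := by
  refine ⟨F 0 + L * (m * n), add_nonneg (h0 0) (by positivity), fun z => ?_⟩
  rw [abs_of_nonneg (quasiEnvelope_nonneg h0 z)]
  have hz : ∀ i j, |z i j| ≤ frobNorm z := by
    intro i j
    refine Real.abs_le_sqrt ?_
    calc z i j ^ 2 ≤ ∑ j, z i j ^ 2 :=
          Finset.single_le_sum (f := fun j => z i j ^ 2) (fun _ _ => sq_nonneg _) (Finset.mem_univ j)
      _ ≤ ∑ i, ∑ j, z i j ^ 2 :=
          Finset.single_le_sum (f := fun i => ∑ j, z i j ^ 2)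
            (fun _ _ => Finset.sum_nonneg fun _ _ => sq_nonneg _) (Finset.mem_univ i)
  have h1 : entrySum (z - 0) ≤ m * n * frobNorm z := by
    rw [sub_zero]
    calc entrySum z ≤ ∑ i : Fin m, ∑ j : Fin n, frobNorm z :=
          Finset.sum_le_sum fun i _ => Finset.sum_le_sum fun j _ => hz i j
      _ = m * n * frobNorm z := by simp; ring
  have h2 := (quasiEnvelope_le_self h0 z).trans (hF z 0)
  have h3 := mul_le_mul_of_nonneg_left h1 hL
  have h4 : 0 ≤ frobNorm z := Real.sqrt_nonneg _
  have h5 := mul_nonneg (h0 0) h4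
  have h6 : 0 ≤ L * (m * n) := by positivity
  nlinarith

end envelope

lemma abs_lineDeriv_le_one {q : (Fin 2 → ℝ) → ℝ} {v : Fin 2 → ℝ}
    (hq : ∀ x t, q (x + t • v) ≤ q x + |t|) (x : Fin 2 → ℝ) : |lineDeriv ℝ q x v| ≤ 1 := by
  have h : LipschitzWith 1 fun t : ℝ => q (x + t • v) := by
    refine LipschitzWith.of_le_add fun s t => ?_
    have := hq (x + t • v) (s - t)
    rwa [add_assoc, ← add_smul, add_sub_cancel, ← Real.dist_eq] at this
  exact norm_deriv_le_of_lipschitz (x₀ := 0) h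

/-- Lipschitz functions with values in `[0, s]` which increase with slope at most one in the
direction `i` and have slope at most one in the direction `j`. -/
def IsStaircase (i j : Fin 2) (s : ℝ) (q : (Fin 2 → ℝ) → ℝ) : Prop :=
  LipschitzWith 2 q ∧ (∀ x, 0 ≤ q x ∧ q x ≤ s) ∧
    (∀ x, 0 ≤ lineDeriv ℝ q x (Pi.single i 1) ∧ lineDeriv ℝ q x (Pi.single i 1) ≤ 1) ∧
    ∀ x, |lineDeriv ℝ q x (Pi.single j 1)| ≤ 1

/-- The staircase functions of `exists_staircase`, described through their line derivatives. -/
lemma exists_staircase_lineDeriv {i j : Fin 2} (hij : i ≠ j) {r : ℝ} (hr : 0 < r) (H : ℕ)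
    (S : Finset (Fin 2 → ℝ)) (h : (Fin 2 → ℝ) → ℕ) (hH : ∀ c ∈ S, 1 ≤ h c ∧ h c ≤ H)
    (hmono : ∀ a ∈ S, ∀ b ∈ S, |b j - a j| < b i - a i → h a < h b) :
    ∃ q, IsStaircase i j (4 * r * H) q ∧
      ∀ᵐ x, ∀ c ∈ S, ‖x - c‖ < r → lineDeriv ℝ q x (Pi.single i 1) = 1 := by
  obtain ⟨q, hlip, hb, hmon, hone⟩ := exists_staircase hij hr H S h hH hmono
  have hL : LipschitzWith 2 q := by
    refine LipschitzWith.of_le_add_mul 2 fun x y => ?_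
    have h1 := dist_le_pi_dist x y i
    have h2 := dist_le_pi_dist x y j
    have h3 := hlip x y
    rw [Real.dist_eq] at h1 h2
    push_cast
    linarith
  have hi : ∀ x, |lineDeriv ℝ q x (Pi.single i 1)| ≤ 1 := abs_lineDeriv_le_one fun x t => by
    have := hlip (x + t • Pi.single i 1) x
    simpa [hij.symm] using this
  refine ⟨q, ⟨hL, hb, fun x => ⟨?_, (le_abs_self _).trans (hi x)⟩,
    abs_lineDeriv_le_one fun x t => ?_⟩, ?_⟩
  · refine Monotone.deriv_nonneg fun s t hst => ?_
    have := hmon (x + s • Pi.single i 1) (t - s) (sub_nonneg.2 hst)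
    rwa [add_assoc, ← add_smul, add_sub_cancel] at this
  · have := hlip (x + t • Pi.single j 1) x
    simpa [hij] using this
  · filter_upwards [hL.ae_lineDifferentiableAt (μ := volume) (Pi.single i 1)] with x hx c hc hxc
    refine le_antisymm ((le_abs_self _).trans (hi x)) ?_
    refine ge_of_tendsto hx.hasLineDerivAt.tendsto_slope_zero_right ?_
    have hcont : Continuous fun t : ℝ => ‖x + t • (Pi.single i 1 : Fin 2 → ℝ) - c‖ := by fun_prop
    have hev : ∀ᶠ t in nhds (0 : ℝ), ‖x + t • (Pi.single i 1 : Fin 2 → ℝ) - c‖ < r :=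
      hcont.continuousAt.eventually_lt continuousAt_const (by simpa using hxc)
    filter_upwards [nhdsWithin_le_nhds hev, self_mem_nhdsWithin] with t ht htpos
    have htpos' : 0 < t := htpos
    have := hone c hc x t htpos'.le hxc ht
    rw [smul_eq_mul, ← div_eq_inv_mul, le_div_iff₀ htpos']
    linarith

lemma jacobianMatrix_apply {m n : ℕ} {φ : (Fin n → ℝ) → (Fin m → ℝ)}
    (hφ : ContDiff ℝ (⊤ : ℕ∞) φ) (x : Fin n → ℝ) (i : Fin m) (j : Fin n) :
    jacobianMatrix φ x i j = fderiv ℝ (fun y => φ y i) x (Pi.single j 1) := by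
  have h := (hφ.differentiable (by simp) x).hasFDerivAt
  rw [(hasFDerivAt_pi'.1 h i).fderiv]
  rfl

section parts

variable {n : ℕ} {u : (Fin n → ℝ) → ℝ}

lemma contDiff_fderiv_apply (hu : ContDiff ℝ (⊤ : ℕ∞) u) (v : Fin n → ℝ) :
    ContDiff ℝ (⊤ : ℕ∞) fun x => fderiv ℝ u x v :=
  (hu.fderiv_right (m := (⊤ : ℕ∞)) (by simp)).clm_apply contDiff_const

lemma integral_fderiv_mul_lineDeriv (hu : ContDiff ℝ (⊤ : ℕ∞) u) (hc : HasCompactSupport u)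
    {C : NNReal} {q : (Fin n → ℝ) → ℝ} (hq : LipschitzWith C q) (v w : Fin n → ℝ) :
    ∫ x, fderiv ℝ u x v * lineDeriv ℝ q x w = -∫ x, fderiv ℝ (fderiv ℝ u) x w v * q x := by
  have hc' : HasCompactSupport fun x => fderiv ℝ u x v :=
    (hc.fderiv ℝ).comp_left (g := fun l : (Fin n → ℝ) →L[ℝ] ℝ => l v) rfl
  have hs := contDiff_fderiv_apply hu v
  obtain ⟨D, hD⟩ := hs.lipschitzWith_of_hasCompactSupport hc' (by simp)
  simp_rw [mul_comm (fderiv ℝ u _ v)]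
  rw [hq.integral_lineDeriv_mul_eq hD hc' w, ← integral_neg]
  congr 1
  ext x
  have hd : DifferentiableAt ℝ (fderiv ℝ u) x :=
    (hu.fderiv_right (m := (⊤ : ℕ∞)) (by simp)).differentiable (by simp) x
  rw [lineDeriv_neg, (hs.differentiable (by simp) x).lineDeriv_eq_fderiv,
    fderiv_clm_apply hd (differentiableAt_const v)]
  simp

/-- The Jacobian determinant of a pair consisting of a test function and a Lipschitz function has
zero integral. -/
lemma integral_fderiv_mul_lineDeriv_comm (hu : ContDiff ℝ (⊤ : ℕ∞) u) (hc : HasCompactSupport u)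
    {C : NNReal} {q : (Fin n → ℝ) → ℝ} (hq : LipschitzWith C q) (v w : Fin n → ℝ) :
    ∫ x, fderiv ℝ u x v * lineDeriv ℝ q x w = ∫ x, fderiv ℝ u x w * lineDeriv ℝ q x v := by
  rw [integral_fderiv_mul_lineDeriv hu hc hq, integral_fderiv_mul_lineDeriv hu hc hq]
  congr 2
  ext x
  rw [hu.contDiffAt.isSymmSndFDerivAt (by simpa using ENat.LEInfty.out)]

lemma integral_fderiv_apply_eq_zero (hu : ContDiff ℝ (⊤ : ℕ∞) u) (hc : HasCompactSupport u)
    (v : Fin n → ℝ) : ∫ x, fderiv ℝ u x v = 0 := by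
  obtain ⟨D, hD⟩ := hu.lipschitzWith_of_hasCompactSupport hc (by simp)
  have h := (LipschitzWith.const (1 : ℝ) : LipschitzWith 0 fun _ : Fin n → ℝ => (1 : ℝ))
    |>.integral_lineDeriv_mul_eq (μ := volume) hD hc (-v)
  simp only [lineDeriv, deriv_const, zero_mul, integral_zero, neg_neg, mul_one] at h
  rw [h]
  congr 1
  ext x
  exact ((hu.differentiable (by simp) x).lineDeriv_eq_fderiv).symm

end parts

/-- A Lipschitz function which is nonnegative, bounded and increasing in one direction has a small
derivative in that direction on average over the unit square. -/
lemma IsStaircase.integral_unitCube_le {i j : Fin 2} {s : ℝ} {q : (Fin 2 → ℝ) → ℝ}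
    (h : IsStaircase i j s q) :
    ∫ x in unitCube 2, lineDeriv ℝ q x (Pi.single i 1) ≤ 9 * s := by
  obtain ⟨hq, hb, hmon, -⟩ := h
  set v : Fin 2 → ℝ := Pi.single i 1 with hv
  set B : Set (Fin 2 → ℝ) := Set.Icc 0 1 with hB
  set χ : (Fin 2 → ℝ) → ℝ := fun x => max 0 (1 - Metric.infDist x B) with hχ
  have hB0 : B.Nonempty := ⟨0, le_rfl, zero_le_one⟩
  have hχL : LipschitzWith 1 χ := by
    refine LipschitzWith.of_le_add fun x y => ?_
    have := Metric.infDist_le_infDist_add_dist (s := B) (x := y) (y := x)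
    rw [dist_comm] at this
    refine max_le ?_ ?_
    · exact add_nonneg (le_max_left _ _) dist_nonneg
    · have := le_max_right 0 (1 - Metric.infDist y B)
      simp only [hχ]; linarith
  set T : Set (Fin 2 → ℝ) := Set.Icc (-1) 2 with hT
  have hzero : ∀ x, x ∉ T → χ x = 0 := by
    intro x hx
    refine max_eq_left ?_
    rw [sub_nonpos]
    by_contra! hlt
    obtain ⟨y, hy, hxy⟩ := (Metric.infDist_lt_iff hB0).1 hlt
    refine hx ⟨fun k => ?_, fun k => ?_⟩ <;>
    · have h1 := (dist_le_pi_dist x y k).trans hxy.le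
      rw [Real.dist_eq, abs_le] at h1
      have h2 := hy.1 k
      have h3 := hy.2 k
      simp only [Pi.neg_apply, Pi.ofNat_apply] at *
      linarith
  have hTc : IsCompact T := isCompact_Icc
  have hχc : HasCompactSupport χ := HasCompactSupport.intro hTc hzero
  have hone : ∀ x ∈ unitCube 2, χ x = 1 := by
    intro x hx
    have hxB : x ∈ B := ⟨fun k => (mem_unitCube.1 hx k).1.le, fun k => (mem_unitCube.1 hx k).2.le⟩
    simp [hχ, Metric.infDist_zero_of_mem hxB]
  have hmeas : Measurable fun x => lineDeriv ℝ q x v := measurable_lineDeriv hq.continuous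
  have h_int : Integrable fun x => lineDeriv ℝ q x v * χ x := by
    refine (hχL.continuous.integrable_of_hasCompactSupport hχc).bdd_mul (c := 1)
      hmeas.aestronglyMeasurable (Filter.Eventually.of_forall fun x => ?_)
    rw [Real.norm_eq_abs, abs_of_nonneg (hmon x).1]
    exact (hmon x).2
  have hnn : ∀ x, 0 ≤ lineDeriv ℝ q x v * χ x :=
    fun x => mul_nonneg (hmon x).1 (le_max_left _ _)
  have hder : ∀ x, lineDeriv ℝ χ x (-v) * q x ≤ T.indicator (fun _ => s) x := by
    intro x
    by_cases hx : x ∈ T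
    · rw [Set.indicator_of_mem hx]
      have h1 : |lineDeriv ℝ χ x (-v)| ≤ 1 := by
        refine abs_lineDeriv_le_one (fun x t => ?_) x
        have := hχL.le_add_mul (x + t • -v) x
        simpa [dist_eq_norm, norm_smul, hv, Pi.norm_single] using this
      calc lineDeriv ℝ χ x (-v) * q x ≤ 1 * q x :=
            mul_le_mul_of_nonneg_right ((le_abs_self _).trans h1) (hb x).1
        _ ≤ s := by rw [one_mul]; exact (hb x).2
    · rw [Set.indicator_of_notMem hx]
      have : χ =ᶠ[nhds x] fun _ => 0 := by
        filter_upwards [hTc.isClosed.isOpen_compl.mem_nhds hx] with y hy using hzero y hy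
      rw [this.lineDeriv_eq, lineDeriv, deriv_const, zero_mul]
  calc ∫ x in unitCube 2, lineDeriv ℝ q x v
      = ∫ x in unitCube 2, lineDeriv ℝ q x v * χ x :=
        setIntegral_congr_fun (measurableSet_unitCube 2) fun x hx => by simp [hone x hx]
    _ ≤ ∫ x, lineDeriv ℝ q x v * χ x :=
        setIntegral_le_integral h_int (Filter.Eventually.of_forall hnn)
    _ = ∫ x, lineDeriv ℝ χ x (-v) * q x := hq.integral_lineDeriv_mul_eq hχL hχc v
    _ ≤ ∫ x, T.indicator (fun _ => s) x := by
        by_cases hi : Integrable fun x => lineDeriv ℝ χ x (-v) * q x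
        · refine integral_mono hi ?_ hder
          exact (integrable_indicator_iff hTc.measurableSet).2
            (integrableOn_const hTc.measure_lt_top.ne)
        · rw [integral_undef hi]
          refine integral_nonneg fun x => Set.indicator_nonneg (fun _ _ => ?_) x
          exact (hb 0).1.trans (hb 0).2
    _ = 9 * s := by
        rw [integral_indicator hTc.measurableSet, setIntegral_const, smul_eq_mul]
        congr 1
        rw [Measure.real, Real.volume_Icc_pi_toReal]
        · norm_num
        · intro k; norm_num

/-- The set where a function with small mean is large can be covered by the sets where one of two
staircase functions has full slope. -/
lemma exists_staircase_cover {a : (Fin 2 → ℝ) → ℝ} (ha : Continuous a) {N : ℕ} (hN : 0 < N) {P : ℝ}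
    (hP : 0 < P) (hosc : ∀ x y, ‖x - y‖ ≤ ((288 * N : ℕ) : ℝ)⁻¹ → |a x - a y| ≤ P / 2)
    (h_int : ∫ x in unitCube 2, max (a x) 0 ≤ P / (2 * 288 ^ 2)) :
    ∃ q p, IsStaircase 1 0 (1 / 72) q ∧ IsStaircase 0 1 (1 / 72) p ∧
      ∀ᵐ x, x ∈ unitCube 2 → 3 / 2 * P < a x →
        lineDeriv ℝ q x (Pi.single 1 1) = 1 ∨ lineDeriv ℝ p x (Pi.single 0 1) = 1 := by
  classical
  set n := 288 * N with hn
  have hn0 : 0 < n := by positivity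
  have hN' : (0 : ℝ) < N := by exact_mod_cast hN
  have hnR : (n : ℝ) = 288 * N := by rw [hn]; push_cast; ring
  have hn' : (0 : ℝ) < n := by exact_mod_cast hn0
  set r : ℝ := (n : ℝ)⁻¹ with hr
  have hr0 : 0 < r := inv_pos.2 hn'
  set g : (Fin 2 → Fin n) → (Fin 2 → ℝ) := fun k => r • fun i => ((k i : ℕ) : ℝ) with hg
  set T : Finset (Fin 2 → Fin n) := Finset.univ.filter fun k => P ≤ a (g k) with hT
  have hTcard : T.card ≤ N ^ 2 := by
    have hm : Continuous fun x => max (a x) 0 := ha.max continuous_const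
    rw [integral_unitCube_eq_sum (integrableOn_unitCube hm) hn0] at h_int
    have h1 : (T.card : ℝ) * (P / 2) ≤ ∑ k : Fin 2 → Fin n,
        ∫ y in unitCube 2, max (a (r • (y + fun i => ((k i : ℕ) : ℝ)))) 0 := by
      rw [← nsmul_eq_mul, ← Finset.sum_const]
      refine (Finset.sum_le_sum fun k hk => ?_).trans (Finset.sum_le_sum_of_subset_of_nonneg
        (Finset.subset_univ T) fun k _ _ => integral_nonneg fun _ => le_max_right _ _)
      rw [← integral_const_unitCube 2 (P / 2)]
      refine setIntegral_mono_on (integrableOn_unitCube continuous_const)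
        (integrableOn_unitCube (hm.comp (by fun_prop))) (measurableSet_unitCube 2) fun y hy => ?_
      refine le_max_of_le_left ?_
      have h2 := hosc _ _ (norm_smul_sub_smul_le hn0 hy fun i => ((k i : ℕ) : ℝ))
      have h3 : P ≤ a (g k) := (Finset.mem_filter.1 hk).2
      have h4 := (abs_le.1 h2).1
      simp only [hg] at h3
      linarith
    have h2 : (T.card : ℝ) * (P / 2) ≤ P / (2 * 288 ^ 2) * n ^ 2 := by
      rw [inv_mul_le_iff₀ (by positivity), mul_comm] at h_int
      exact h1.trans h_int
    rw [hnR] at h2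
    have h3 : (T.card : ℝ) ≤ N ^ 2 := by
      have : P / (2 * 288 ^ 2) * (288 * N) ^ 2 = (N : ℝ) ^ 2 * (P / 2) := by ring
      rw [this] at h2
      exact le_of_mul_le_mul_right h2 (by positivity)
    exact_mod_cast h3
  set S : Finset (Fin 2 → ℝ) := T.image g with hS
  have hScard : S.card ≤ N * (N + 1) := by
    refine Finset.card_image_le.trans (hTcard.trans ?_)
    nlinarith
  obtain ⟨S₁, S₂, hS12, ⟨h₁, hh₁, hm₁⟩, h₂, hh₂, hm₂⟩ := exists_rank_split
    (fun a b : Fin 2 → ℝ => |b 0 - a 0| < b 1 - a 1)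
    (fun a b : Fin 2 → ℝ => |b 1 - a 1| < b 0 - a 0)
    (fun a => by simp)
    (fun a b c hab hbc => by
      simp only [abs_lt] at *; constructor <;> linarith)
    (fun a => by simp)
    (fun a b c hab hbc => by
      simp only [abs_lt] at *; constructor <;> linarith)
    (fun a b hab => by
      simp only [abs_lt] at *
      constructor <;>
      · rintro ⟨h1, h2⟩
        linarith) N N S hScard
  have hs : 4 * r * N = 1 / 72 := by
    rw [hr, hnR]; field_simp; norm_num
  obtain ⟨q, hq, hq1⟩ := exists_staircase_lineDeriv (i := 1) (j := 0) (by decide) hr0 N S₁ h₁ hh₁ hm₁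
  obtain ⟨p, hp, hp1⟩ := exists_staircase_lineDeriv (i := 0) (j := 1) (by decide) hr0 N S₂ h₂ hh₂ hm₂
  rw [hs] at hq hp
  refine ⟨q, p, hq, hp, ?_⟩
  filter_upwards [hq1, hp1] with x hxq hxp hx hax
  have hx' := mem_unitCube.1 hx
  have hfl : ∀ i, ⌊n * x i⌋₊ < n := fun i => by
    rw [Nat.floor_lt (by have := (hx' i).1; positivity)]
    nlinarith [(hx' i).2]
  set k : Fin 2 → Fin n := fun i => ⟨⌊n * x i⌋₊, hfl i⟩ with hk
  have hxk : ‖x - g k‖ < r := by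
    rw [pi_norm_lt_iff hr0]
    intro i
    have h1 : (⌊n * x i⌋₊ : ℝ) ≤ n * x i := Nat.floor_le (by have := (hx' i).1; positivity)
    have h2 := Nat.lt_floor_add_one (n * x i)
    have h3 : (x - g k) i = r * (n * x i - ⌊n * x i⌋₊) := by
      simp only [hg, hk, Pi.sub_apply, Pi.smul_apply, smul_eq_mul, hr]
      field_simp
    rw [h3, norm_mul, Real.norm_of_nonneg hr0.le, Real.norm_of_nonneg (by linarith)]
    nlinarith
  have hkT : g k ∈ S := by
    refine Finset.mem_image_of_mem g (Finset.mem_filter.2 ⟨Finset.mem_univ _, ?_⟩)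
    have := (abs_le.1 (hosc _ _ hxk.le)).2
    linarith
  rw [hS12, Finset.mem_union] at hkT
  exact hkT.imp (fun h => hxq _ h hxk) (fun h => hxp _ h hxk)

/-- A sum of distances to linear conditions, with minimum on the multiples `t • 1`, `t ∈ K`, of the
identity matrix. -/
noncomputable def wellDist (K : Set ℝ) (z : Matrix (Fin 2) (Fin 2) ℝ) : ℝ :=
  |z 0 1| + |z 1 0| + |z 0 0 - z 1 1| + Metric.infDist (z 0 0) K

lemma wellDist_nonneg (K : Set ℝ) (z : Matrix (Fin 2) (Fin 2) ℝ) : 0 ≤ wellDist K z := by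
  have := Metric.infDist_nonneg (x := z 0 0) (s := K)
  unfold wellDist
  positivity

lemma entryLipschitz_wellDist (K : Set ℝ) : EntryLipschitz 2 (wellDist K) := by
  intro z w
  have h1 := Metric.infDist_le_infDist_add_dist (s := K) (x := z 0 0) (y := w 0 0)
  rw [Real.dist_eq] at h1
  have h2 := abs_sub_abs_le_abs_sub (z 0 1) (w 0 1)
  have h3 := abs_sub_abs_le_abs_sub (z 1 0) (w 1 0)
  have h4 := abs_sub_abs_le_abs_sub (z 0 0 - z 1 1) (w 0 0 - w 1 1)
  have h5 : |z 0 0 - z 1 1 - (w 0 0 - w 1 1)| ≤ |z 0 0 - w 0 0| + |z 1 1 - w 1 1| := by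
    rw [sub_sub_sub_comm]; exact abs_sub _ _
  have h6 := abs_nonneg (z 0 1 - w 0 1)
  have h7 := abs_nonneg (z 1 0 - w 1 0)
  have h8 := abs_nonneg (z 1 1 - w 1 1)
  simp only [wellDist, entrySum, Fin.sum_univ_two, Matrix.sub_apply]
  linarith

lemma wellDist_smul_one {K : Set ℝ} {t : ℝ} (ht : t ∈ K) : wellDist K (t • 1) = 0 := by
  simp [wellDist, Metric.infDist_zero_of_mem ht]

section lower

variable {K : Set ℝ} {w M : ℝ}

lemma neg_le_infDist (hK : K.Nonempty) (hw : 0 < w) (hM : 1000000 ≤ M)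
    (hKw : ∀ t ∈ K, 0 ≤ t ∧ t ≤ w / M ∨ M * w ≤ t) (α : ℝ) : -α ≤ Metric.infDist α K := by
  refine (Metric.le_infDist hK).2 fun t ht => ?_
  rw [Real.dist_eq]
  have h1 := neg_abs_le (α - t)
  have h2 : 0 ≤ t := by
    rcases hKw t ht with h | h
    · exact h.1
    · exact le_trans (by positivity) h
  linarith

lemma le_add_infDist (hK : K.Nonempty) (hw : 0 < w) (hM : 1000000 ≤ M)
    (hKw : ∀ t ∈ K, 0 ≤ t ∧ t ≤ w / M ∨ M * w ≤ t) {α : ℝ} (hα : α ≤ 3 / 4 * (M * w)) :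
    α ≤ w / M + 3 * Metric.infDist α K := by
  have h : (α - w / M) / 3 ≤ Metric.infDist α K := by
    refine (Metric.le_infDist hK).2 fun t ht => ?_
    rw [Real.dist_eq]
    have h0 : 0 ≤ w / M := by positivity
    have h1 := neg_abs_le (α - t)
    have h2 := le_abs_self (α - t)
    rcases hKw t ht with h | h <;> linarith [abs_nonneg (α - t)]
  linarith

lemma staircase_pointwise (hK : K.Nonempty) (hw : 0 < w) (hM : 1000000 ≤ M)
    (hKw : ∀ t ∈ K, 0 ≤ t ∧ t ≤ w / M ∨ M * w ≤ t) (z : Matrix (Fin 2) (Fin 2) ℝ) {s t : ℝ}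
    (hs : 0 ≤ s ∧ s ≤ 1) (ht : 0 ≤ t ∧ t ≤ 1) (h : 3 / 4 * (M * w) < z 0 0 → s = 1 ∨ t = 1) :
    z 0 0 - w / M - 5 * wellDist K z ≤ z 0 0 * s + z 1 1 * t := by
  have h1 := neg_le_infDist hK hw hM hKw (z 0 0)
  have h2 : wellDist K z = |z 0 1| + |z 1 0| + |z 0 0 - z 1 1| + Metric.infDist (z 0 0) K := rfl
  have h3 := abs_nonneg (z 0 1)
  have h4 := abs_nonneg (z 1 0)
  have h5 := le_abs_self (z 0 0 - z 1 1)
  have h6 := abs_nonneg (z 0 0 - z 1 1)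
  have h7 : (z 0 0 - |z 0 0 - z 1 1|) * t ≤ z 1 1 * t :=
    mul_le_mul_of_nonneg_right (by linarith) ht.1
  have h8 : |z 0 0 - z 1 1| * t ≤ |z 0 0 - z 1 1| * 1 := mul_le_mul_of_nonneg_left ht.2 h6
  have h9 : 0 ≤ Metric.infDist (z 0 0) K := Metric.infDist_nonneg
  have h10 : 0 ≤ w / M := by positivity
  rcases le_or_gt 0 (z 0 0) with h0 | h0
  · by_cases hc : 3 / 4 * (M * w) < z 0 0
    · rcases h hc with rfl | rfl
      · nlinarith [mul_nonneg h0 ht.1]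
      · nlinarith [mul_nonneg h0 hs.1]
    · have h11 := le_add_infDist hK hw hM hKw (not_lt.1 hc)
      nlinarith [mul_nonneg h0 hs.1, mul_nonneg h0 ht.1]
  · have h11 : z 0 0 * 1 ≤ z 0 0 * s := mul_le_mul_of_nonpos_left hs.2 h0.le
    have h12 : z 0 0 * 1 ≤ z 0 0 * t := mul_le_mul_of_nonpos_left ht.2 h0.le
    nlinarith

end lower

lemma integrableOn_mul_of_abs_le_one {f g : (Fin 2 → ℝ) → ℝ} (hf : Continuous f)
    (hg : Measurable g) (hb : ∀ x, |g x| ≤ 1) : IntegrableOn (fun x => f x * g x) (unitCube 2) :=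
  (integrableOn_unitCube hf).mul_bdd (c := 1) hg.aestronglyMeasurable
    (Filter.Eventually.of_forall hb)

lemma abs_le_one_of_mem {t : ℝ} (h : 0 ≤ t ∧ t ≤ 1) : |t| ≤ 1 := by
  rw [abs_of_nonneg h.1]; exact h.2

section testmap

variable {m n : ℕ} {φ : (Fin n → ℝ) → (Fin m → ℝ)}

lemma setIntegral_jacobianMatrix_mul (hφ : φ ∈ testMaps m n) (i : Fin m) (j : Fin n)
    (g : (Fin n → ℝ) → ℝ) : ∫ x in unitCube n, jacobianMatrix φ x i j * g x =
      ∫ x, fderiv ℝ (fun y => φ y i) x (Pi.single j 1) * g x := by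
  rw [setIntegral_eq_integral_of_forall_compl_eq_zero]
  · simp_rw [jacobianMatrix_apply hφ.1]
  · intro x hx
    rw [jacobianMatrix_eq_zero fun h => hx (hφ.2.2 h)]
    simp

lemma hasCompactSupport_entry (hφ : φ ∈ testMaps m n) (i : Fin m) :
    HasCompactSupport fun y => φ y i :=
  hφ.2.1.comp_left (g := fun y : Fin m → ℝ => y i) rfl

lemma setIntegral_jacobianMatrix (hφ : φ ∈ testMaps m n) (i : Fin m) (j : Fin n) :
    ∫ x in unitCube n, jacobianMatrix φ x i j = 0 := by
  have h := setIntegral_jacobianMatrix_mul hφ i j fun _ => 1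
  simp only [mul_one] at h
  rw [h]
  exact integral_fderiv_apply_eq_zero (contDiff_pi.1 hφ.1 i) (hasCompactSupport_entry hφ i) _

lemma setIntegral_jacobianMatrix_mul_comm (hφ : φ ∈ testMaps m n) {C : NNReal}
    {q : (Fin n → ℝ) → ℝ} (hq : LipschitzWith C q) (i : Fin m) (j l : Fin n) :
    ∫ x in unitCube n, jacobianMatrix φ x i j * lineDeriv ℝ q x (Pi.single l 1) =
      ∫ x in unitCube n, jacobianMatrix φ x i l * lineDeriv ℝ q x (Pi.single j 1) := by
  rw [setIntegral_jacobianMatrix_mul hφ, setIntegral_jacobianMatrix_mul hφ]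
  exact integral_fderiv_mul_lineDeriv_comm (contDiff_pi.1 hφ.1 i) (hasCompactSupport_entry hφ i)
    hq _ _

end testmap

lemma IsStaircase.setIntegral_mul_le {q : (Fin 2 → ℝ) → ℝ} {s : ℝ} {i j : Fin 2}
    (hq : IsStaircase i j s q) {φ : (Fin 2 → ℝ) → (Fin 2 → ℝ)} (hφ : φ ∈ testMaps 2 2) (k : Fin 2) :
    ∫ x in unitCube 2, jacobianMatrix φ x k j * lineDeriv ℝ q x (Pi.single i 1) ≤
      ∫ x in unitCube 2, |jacobianMatrix φ x k i| := by
  have hc : Continuous fun x => jacobianMatrix φ x k i :=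
    (continuous_jacobianMatrix hφ.1).matrix_elem k i
  rw [setIntegral_jacobianMatrix_mul_comm hφ hq.1]
  refine integral_mono (integrableOn_mul_of_abs_le_one hc
    (measurable_lineDeriv hq.1.continuous) hq.2.2.2) (integrableOn_unitCube hc.abs) fun x => ?_
  refine (le_abs_self _).trans ?_
  rw [abs_mul]
  exact mul_le_of_le_one_right (abs_nonneg _) (hq.2.2.2 x)

/-- A lower bound for the energy of test maps around a point far away from the wells. -/
theorem le_integral_wellDist {K : Set ℝ} {w M : ℝ} (hK : K.Nonempty) (hw : 0 < w)
    (hM : 1000000 ≤ M) (hKw : ∀ t ∈ K, 0 ≤ t ∧ t ≤ w / M ∨ M * w ≤ t)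
    {φ : (Fin 2 → ℝ) → (Fin 2 → ℝ)} (hφ : φ ∈ testMaps 2 2) :
    w / 10 ≤ ∫ x in unitCube 2, wellDist K (w • 1 + jacobianMatrix φ x) := by
  by_contra! hlt
  set z : (Fin 2 → ℝ) → Matrix (Fin 2) (Fin 2) ℝ := fun x => w • 1 + jacobianMatrix φ x with hz
  set E := ∫ x in unitCube 2, wellDist K (z x) with hE
  have hJ : ∀ i j, Continuous fun x => jacobianMatrix φ x i j :=
    fun i j => (continuous_jacobianMatrix hφ.1).matrix_elem i j
  have hzc : Continuous z := continuous_const.add (continuous_jacobianMatrix hφ.1)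
  have hz00 : ∀ x, z x 0 0 = w + jacobianMatrix φ x 0 0 := fun x => by simp [hz]
  have hz11 : ∀ x, z x 1 1 = w + jacobianMatrix φ x 1 1 := fun x => by simp [hz]
  have hz01 : ∀ x, z x 0 1 = jacobianMatrix φ x 0 1 := fun x => by simp [hz]
  have hz10 : ∀ x, z x 1 0 = jacobianMatrix φ x 1 0 := fun x => by simp [hz]
  have hac : Continuous fun x => z x 0 0 := hzc.matrix_elem 0 0
  have hDc : Continuous fun x => wellDist K (z x) := (entryLipschitz_wellDist K).continuous.comp hzc
  have hDi := integrableOn_unitCube hDc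
  have hai := integrableOn_unitCube hac
  have hmean : ∫ x in unitCube 2, z x 0 0 = w := by
    simp_rw [hz00]
    rw [integral_add (integrableOn_unitCube continuous_const) (integrableOn_unitCube (hJ 0 0)),
      integral_const_unitCube, setIntegral_jacobianMatrix hφ, add_zero]
  have hpos : ∫ x in unitCube 2, max (z x 0 0) 0 ≤ M * w / 2 / (2 * 288 ^ 2) := by
    have h1 : ∫ x in unitCube 2, max (z x 0 0) 0 ≤
        ∫ x in unitCube 2, (z x 0 0 + wellDist K (z x)) := by
      refine integral_mono (integrableOn_unitCube (hac.max continuous_const)) (hai.add hDi)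
        fun x => ?_
      have h2 := neg_le_infDist hK hw hM hKw (z x 0 0)
      have h3 : Metric.infDist (z x 0 0) K ≤ wellDist K (z x) := by
        unfold wellDist
        have := abs_nonneg (z x 0 1)
        have := abs_nonneg (z x 1 0)
        have := abs_nonneg (z x 0 0 - z x 1 1)
        linarith
      exact max_le (by linarith [wellDist_nonneg K (z x)]) (by linarith)
    rw [integral_add hai hDi, hmean] at h1
    nlinarith
  obtain ⟨δ, hδ, hosc⟩ := exists_mesh hφ (ε := M * w / 2 / 2) (by positivity)
  obtain ⟨N', hN'⟩ := exists_nat_one_div_lt hδ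
  obtain ⟨q, p, hq, hp, hcov⟩ := exists_staircase_cover hac (Nat.succ_pos N') (P := M * w / 2)
    (by positivity) (fun x y hxy => by
      have h1 : ‖x - y‖ < δ := by
        refine hxy.trans_lt (lt_of_le_of_lt ?_ hN')
        rw [one_div]
        refine inv_anti₀ (by positivity) ?_
        push_cast
        nlinarith [Nat.cast_nonneg (α := ℝ) N']
      have h2 := (hosc x y h1).le
      rw [hz00, hz00, add_sub_add_left_eq_sub]
      refine le_trans ?_ h2
      simp only [entrySum, Fin.sum_univ_two, Matrix.sub_apply]
      have := abs_nonneg (jacobianMatrix φ x 0 1 - jacobianMatrix φ y 0 1)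
      have := abs_nonneg (jacobianMatrix φ x 1 0 - jacobianMatrix φ y 1 0)
      have := abs_nonneg (jacobianMatrix φ x 1 1 - jacobianMatrix φ y 1 1)
      linarith) hpos
  set Q' : (Fin 2 → ℝ) → ℝ := fun x => lineDeriv ℝ q x (Pi.single 1 1) with hQ'
  set P' : (Fin 2 → ℝ) → ℝ := fun x => lineDeriv ℝ p x (Pi.single 0 1) with hP'
  have hQm : Measurable Q' := measurable_lineDeriv hq.1.continuous
  have hPm : Measurable P' := measurable_lineDeriv hp.1.continuous
  have hQb : ∀ x, |Q' x| ≤ 1 := fun x => abs_le_one_of_mem (hq.2.2.1 x)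
  have hPb : ∀ x, |P' x| ≤ 1 := fun x => abs_le_one_of_mem (hp.2.2.1 x)
  have i1 := integrableOn_mul_of_abs_le_one (continuous_const (y := w)) hQm hQb
  have i2 := integrableOn_mul_of_abs_le_one (hJ 0 0) hQm hQb
  have i3 := integrableOn_mul_of_abs_le_one (continuous_const (y := w)) hPm hPb
  have i4 := integrableOn_mul_of_abs_le_one (hJ 1 1) hPm hPb
  have i12 : IntegrableOn (fun x => w * Q' x + jacobianMatrix φ x 0 0 * Q' x) (unitCube 2) :=
    i1.add i2
  have i34 : IntegrableOn (fun x => w * P' x + jacobianMatrix φ x 1 1 * P' x) (unitCube 2) :=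
    i3.add i4
  have i5 : IntegrableOn (fun x => z x 0 0 - w / M) (unitCube 2) :=
    hai.sub (integrableOn_unitCube continuous_const)
  have hlow : ∫ x in unitCube 2, (z x 0 0 - w / M - 5 * wellDist K (z x)) ≤
      ∫ x in unitCube 2, ((w * Q' x + jacobianMatrix φ x 0 0 * Q' x) +
        (w * P' x + jacobianMatrix φ x 1 1 * P' x)) := by
    refine integral_mono_ae (integrableOn_unitCube (by fun_prop)) (i12.add i34) ?_
    rw [Filter.EventuallyLE, ae_restrict_iff' (measurableSet_unitCube 2)]
    filter_upwards [hcov] with x hx hxQ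
    have h1 := staircase_pointwise hK hw hM hKw (z x) (hq.2.2.1 x) (hp.2.2.1 x)
      (fun h => hx hxQ (by linarith))
    have h2 : z x 0 0 * lineDeriv ℝ q x (Pi.single 1 1) + z x 1 1 * lineDeriv ℝ p x (Pi.single 0 1)
        = (w * Q' x + jacobianMatrix φ x 0 0 * Q' x) +
          (w * P' x + jacobianMatrix φ x 1 1 * P' x) := by
      rw [hz00, hz11]; ring
    linarith
  have hleft : ∫ x in unitCube 2, (z x 0 0 - w / M - 5 * wellDist K (z x)) = w - w / M - 5 * E := by
    rw [integral_sub i5 (hDi.const_mul 5),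
      integral_sub hai (integrableOn_unitCube continuous_const), hmean, integral_const_unitCube,
      integral_const_mul]
  have hright : ∫ x in unitCube 2, ((w * Q' x + jacobianMatrix φ x 0 0 * Q' x) +
        (w * P' x + jacobianMatrix φ x 1 1 * P' x)) =
      w * (∫ x in unitCube 2, Q' x) + (∫ x in unitCube 2, jacobianMatrix φ x 0 0 * Q' x) +
        (w * (∫ x in unitCube 2, P' x) + ∫ x in unitCube 2, jacobianMatrix φ x 1 1 * P' x) := by
    rw [integral_add i12 i34, integral_add i1 i2, integral_add i3 i4,
      integral_const_mul, integral_const_mul]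
  have hQ1 : ∫ x in unitCube 2, Q' x ≤ 9 * (1 / 72) := hq.integral_unitCube_le
  have hP1 : ∫ x in unitCube 2, P' x ≤ 9 * (1 / 72) := hp.integral_unitCube_le
  have hQ2 : ∫ x in unitCube 2, jacobianMatrix φ x 0 0 * Q' x ≤
      ∫ x in unitCube 2, |jacobianMatrix φ x 0 1| := hq.setIntegral_mul_le hφ 0
  have hP2 : ∫ x in unitCube 2, jacobianMatrix φ x 1 1 * P' x ≤
      ∫ x in unitCube 2, |jacobianMatrix φ x 1 0| := hp.setIntegral_mul_le hφ 1
  have hoff : (∫ x in unitCube 2, |jacobianMatrix φ x 0 1|) +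
      (∫ x in unitCube 2, |jacobianMatrix φ x 1 0|) ≤ E := by
    have j1 := integrableOn_unitCube (hJ 0 1).abs
    have j2 := integrableOn_unitCube (hJ 1 0).abs
    rw [← integral_add j1 j2]
    refine integral_mono (j1.add j2) hDi fun x => ?_
    have h1 := abs_nonneg (z x 0 0 - z x 1 1)
    have h2 := Metric.infDist_nonneg (x := z x 0 0) (s := K)
    simp only [wellDist, hz01, hz10]
    linarith
  have hwM : w / M ≤ w / 1000000 := div_le_div_of_nonneg_left hw.le (by norm_num) hM
  have hwQ := mul_le_mul_of_nonneg_left hQ1 hw.le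
  have hwP := mul_le_mul_of_nonneg_left hP1 hw.le
  rw [hleft, hright] at hlow
  linarith

/-- The origin together with the powers `1000000 ^ k`, `k ∈ A`. -/
def wells (A : Set ℕ) : Set ℝ := insert 0 ((fun k : ℕ => (1000000 : ℝ) ^ k) '' A)

lemma wells_nonempty (A : Set ℕ) : (wells A).Nonempty := ⟨0, Set.mem_insert _ _⟩

lemma wells_gap {A : Set ℕ} {j : ℕ} (hj : j ∉ A) :
    ∀ t ∈ wells A, 0 ≤ t ∧ t ≤ (1000000 : ℝ) ^ j / 1000000 ∨ 1000000 * (1000000 : ℝ) ^ j ≤ t := by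
  rintro t (rfl | ⟨k, hk, rfl⟩)
  · left; exact ⟨le_rfl, by positivity⟩
  · rcases lt_trichotomy k j with h | rfl | h
    · left
      refine ⟨by positivity, ?_⟩
      rw [le_div_iff₀ (by norm_num), ← pow_succ]
      exact pow_le_pow_right₀ (by norm_num) h
    · exact absurd hk hj
    · right
      rw [← pow_succ']
      exact pow_le_pow_right₀ (by norm_num) h

lemma abs_sub_le_dLG_mul {m n : ℕ} {f g : Matrix (Fin m) (Fin n) ℝ → ℝ} (hf : HasLinearGrowth f)
    (hg : HasLinearGrowth g) (z : Matrix (Fin m) (Fin n) ℝ) :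
    |f z - g z| ≤ dLG f g * (1 + frobNorm z) := by
  obtain ⟨C, -, hC⟩ := hf
  obtain ⟨C', -, hC'⟩ := hg
  have hpos : ∀ z : Matrix (Fin m) (Fin n) ℝ, 0 < 1 + frobNorm z :=
    fun z => add_pos_of_pos_of_nonneg one_pos (Real.sqrt_nonneg _)
  have hb : BddAbove (Set.range fun z => |f z - g z| / (1 + frobNorm z)) := by
    refine ⟨C + C', ?_⟩
    rintro _ ⟨z, rfl⟩
    rw [div_le_iff₀ (hpos z), add_mul]
    exact (abs_sub _ _).trans (add_le_add (hC z) (hC' z))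
  rw [← div_le_iff₀ (hpos z)]
  exact le_ciSup hb z

/-- The envelopes attached to two different sets of wells have no common approximation. -/
lemma not_common_approx {A B : Set ℕ} {j : ℕ} (hA : j ∈ A) (hB : j ∉ B)
    {g : Matrix (Fin 2) (Fin 2) ℝ → ℝ} (hg : HasLinearGrowth g)
    (hgA : dLG (quasiEnvelope (wellDist (wells A))) g < 1 / 100)
    (hgB : dLG (quasiEnvelope (wellDist (wells B))) g < 1 / 100) : False := by
  have hgrowth : ∀ A, HasLinearGrowth (quasiEnvelope (wellDist (wells A))) := fun A =>
    hasLinearGrowth_quasiEnvelope (wellDist_nonneg _) zero_le_two (entryLipschitz_wellDist _)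
  set w : ℝ := 1000000 ^ j with hw
  have hw1 : 1 ≤ w := one_le_pow₀ (by norm_num)
  set z : Matrix (Fin 2) (Fin 2) ℝ := w • 1 with hz
  have hfz : frobNorm z ≤ 2 * w := by
    refine Real.sqrt_le_iff.2 ⟨by positivity, ?_⟩
    simp [hz, Fin.sum_univ_two]
    nlinarith
  have h0 : 0 ≤ frobNorm z := Real.sqrt_nonneg _
  have hfA : quasiEnvelope (wellDist (wells A)) z ≤ 0 := by
    refine (quasiEnvelope_le_self (wellDist_nonneg _) z).trans_eq ?_
    exact wellDist_smul_one (Or.inr ⟨j, hA, rfl⟩)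
  have hfB : w / 10 ≤ quasiEnvelope (wellDist (wells B)) z :=
    le_quasiEnvelope fun φ hφ => le_integral_wellDist (wells_nonempty B) (by positivity) le_rfl
      (wells_gap hB) hφ
  have h1 := (abs_sub_le_dLG_mul (hgrowth A) hg z).trans
    (mul_le_mul_of_nonneg_right hgA.le (by linarith))
  have h2 := (abs_sub_le_dLG_mul (hgrowth B) hg z).trans
    (mul_le_mul_of_nonneg_right hgB.le (by linarith))
  have h3 := (abs_le.1 h1).1
  have h4 := (abs_le.1 h2).2
  linarith

/-- The set of continuous quasiconvex functions of linear growth on `2×2` matrices is not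
separable for the metric `d(f,g) = sup_z |f(z)-g(z)|/(1+|z|)`. -/
theorem quasiconvex_linear_growth_not_separable :
    ¬ ∃ D : Set (Matrix (Fin 2) (Fin 2) ℝ → ℝ), D.Countable ∧
      (∀ g ∈ D, Continuous g ∧ IsQuasiconvex g ∧ HasLinearGrowth g) ∧
      ∀ f : Matrix (Fin 2) (Fin 2) ℝ → ℝ,
        Continuous f → IsQuasiconvex f → HasLinearGrowth f →
        ∀ ε > (0 : ℝ), ∃ g ∈ D, dLG f g < ε := by
  rintro ⟨D, hD, hDq, hdense⟩
  have happrox : ∀ A : Set ℕ, ∃ g ∈ D, dLG (quasiEnvelope (wellDist (wells A))) g < 1 / 100 := by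
    intro A
    have hL := entryLipschitz_wellDist (wells A)
    have h0 := wellDist_nonneg (wells A)
    exact hdense _ (entryLipschitz_quasiEnvelope h0 hL).continuous
      (isQuasiconvex_quasiEnvelope h0 zero_le_two hL)
      (hasLinearGrowth_quasiEnvelope h0 zero_le_two hL) _ (by norm_num)
  choose g hgD hg using happrox
  have hinj : Function.Injective fun A : Set ℕ => (⟨g A, hgD A⟩ : D) := by
    intro A B hAB
    have hAB' : g A = g B := congrArg Subtype.val hAB
    ext j
    constructor
    · intro hA
      by_contra hB
      exact not_common_approx hA hB (hDq _ (hgD A)).2.2 (hg A) (hAB' ▸ hg B)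
    · intro hB
      by_contra hA
      exact not_common_approx hB hA (hDq _ (hgD A)).2.2 (hAB' ▸ hg B) (hg A)
  have : Countable D := hD.to_subtype
  have : Countable (Set ℕ) := hinj.countable
  obtain ⟨f, hf⟩ := exists_injective_nat (Set ℕ)
  exact Function.cantor_injective f hf
end
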